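/- arXiv:0709.0287 — 2 statements merged into one kernel-verified Lean document; each statement's English description precedes it below -/
import Mathlib

section
/- If 1 → K → G → Q → 1 is a short exact sequence of groups, then the cohomological dimension of G is at most the cohomological dimension of K plus the cohomological dimension of Q. -/
/-- The cohomological dimension of a group `G`: the supremum (in `ℕ∞`) over all `n`
such that there exists a `G`-module `M` with `H^n(G, M) ≠ 0`. -/
noncomputable def cohDim (G : Type) [Group G] : ℕ∞ :=
  sSup ((fun n : ℕ => (n : ℕ∞)) ''
    {n : ℕ | ∃ M : Rep ℤ G, Nontrivial (groupCohomology M n)})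

open CategoryTheory CategoryTheory.Limits

universe u

namespace Fin

theorem contractNth_zero_cons {α : Type*} {n : ℕ} (op : α → α → α) (a : α)
    (g : Fin (n + 1) → α) :
    contractNth (0 : Fin (n + 2)) op (cons a g : Fin (n + 2) → α) =
      (cons (op a (g 0)) (tail g) : Fin (n + 1) → α) := by
  ext k
  refine Fin.cases ?_ (fun k => ?_) k <;> simp [contractNth, tail]

theorem contractNth_succ_cons {α : Type*} {n : ℕ} (op : α → α → α) (a : α)
    (g : Fin (n + 1) → α) (j : Fin (n + 1)) :
    contractNth j.succ op (cons a g : Fin (n + 2) → α) =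
      (cons a (contractNth j op g) : Fin (n + 1) → α) := by
  ext k
  refine Fin.cases ?_ (fun k => ?_) k <;> simp [contractNth]

end Fin

namespace groupCohomology

/-- A `k`-linear `G`-representation `A` carrying a `G`-equivariant linear retraction
`s : (G → A) → A` of the constant functions has no cohomology in positive degrees. -/
theorem isZero_succ_of_retraction {k G : Type u} [CommRing k] [Group G] (A : Rep.{u} k G)
    (s : (G → A) →ₗ[k] A)
    (hs : ∀ (g : G) (φ : G → A), s (fun x => A.ρ g (φ (g⁻¹ * x))) = A.ρ g (s φ))
    (hc : ∀ a : A, s (fun _ => a) = a) (n : ℕ) :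
    IsZero (groupCohomology A (n + 1)) := by
  refine (HomologicalComplex.exactAt_iff_isZero_homology _ _).1 ?_
  rw [HomologicalComplex.exactAt_iff' _ n (n + 1) (n + 2) (by simp) (by simp),
    ShortComplex.moduleCat_exact_iff]
  intro (f : (Fin (n + 1) → G) → A) hf
  have hf' : inhomogeneousCochains.d A (n + 1) f = 0 := by
    rw [← inhomogeneousCochains.d_def]; exact hf
  suffices h : inhomogeneousCochains.d A n (fun g => s fun x => A.ρ x (f (Fin.cons x⁻¹ g))) = f by
    rw [← inhomogeneousCochains.d_def] at h
    exact ⟨_, h⟩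
  refine funext fun g : Fin (n + 1) → G => ?_
  have key (x : G) : A.ρ x (f (Fin.cons (x⁻¹ * g 0) (Fin.tail g)) +
      ∑ j : Fin (n + 1), (-1 : k) ^ ((j : ℕ) + 1) •
        f (Fin.cons x⁻¹ (Fin.contractNth j (· * ·) g))) = f g := by
    have h : A.ρ x⁻¹ (f g) + ∑ j : Fin (n + 2), (-1 : k) ^ ((j : ℕ) + 1) •
        f (Fin.contractNth j (· * ·) (Fin.cons x⁻¹ g)) = 0 := congrFun hf' (Fin.cons x⁻¹ g)
    rw [Fin.sum_univ_succ] at h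
    simp only [Fin.contractNth_zero_cons, Fin.contractNth_succ_cons, Fin.val_zero, Fin.val_succ,
      pow_succ _ (_ + 1)] at h
    have hx : f (Fin.cons (x⁻¹ * g 0) (Fin.tail g)) +
      ∑ j : Fin (n + 1), (-1 : k) ^ ((j : ℕ) + 1) •
        f (Fin.cons x⁻¹ (Fin.contractNth j (· * ·) g)) = A.ρ x⁻¹ (f g) := by
      rw [← sub_eq_zero, ← neg_eq_zero, ← h]
      simp
      abel
    simp [hx]
  change A.ρ (g 0) (s fun x => A.ρ x (f (Fin.cons x⁻¹ (Fin.tail g)))) +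
    ∑ j : Fin (n + 1), (-1 : k) ^ ((j : ℕ) + 1) •
      s (fun x => A.ρ x (f (Fin.cons x⁻¹ (Fin.contractNth j (· * ·) g)))) = f g
  rw [← hs]
  have e (j : Fin (n + 1)) (φ : G → A) : (-1 : k) ^ ((j : ℕ) + 1) • s φ =
    s ((-1 : k) ^ ((j : ℕ) + 1) • φ) := (map_smul s _ _).symm
  simp only [e, ← map_sum, ← map_add]
  conv_rhs => rw [← hc (f g)]
  congr 1
  funext x
  rw [← key x]
  simp [Fin.tail_def, ← Module.End.mul_apply, ← map_mul]

section LongExactSequence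

variable {k G : Type u} [CommRing k] [Group G] {X : ShortComplex (Rep.{u} k G)}

theorem isZero_succ_X₁ (hX : X.ShortExact) {n : ℕ}
    (h₂ : IsZero (groupCohomology X.X₂ (n + 1))) (h₃ : IsZero (groupCohomology X.X₃ n)) :
    IsZero (groupCohomology X.X₁ (n + 1)) :=
  have := epi_δ_of_isZero hX n h₂
  h₃.of_epi (δ hX n (n + 1) rfl)

theorem isZero_X₃ (hX : X.ShortExact) {n : ℕ}
    (h₁ : IsZero (groupCohomology X.X₁ (n + 1))) (h₂ : IsZero (groupCohomology X.X₂ n)) :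
    IsZero (groupCohomology X.X₃ n) :=
  have := mono_δ_of_isZero hX n h₂
  h₁.of_mono (δ hX n (n + 1) rfl)

end LongExactSequence

end groupCohomology

namespace Rep

section Functions

variable (k G : Type u) [CommRing k] [Group G] (V : Type u) [AddCommGroup V] [Module k V]

/-- The representation of `G` on the functions `G → V` by left translation. -/
noncomputable abbrev functions : Rep.{u} k G :=
  Rep.of (X := G → V)
    { toFun g := LinearMap.funLeft k V (g⁻¹ * ·)
      map_one' := by ext; simp
      map_mul' g h := by ext; simp [mul_assoc] }

theorem functions_ρ_apply (g : G) (φ : G → V) (x : G) :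
    (functions k G V).ρ g φ x = φ (g⁻¹ * x) := rfl

theorem isZero_groupCohomology_functions (n : ℕ) :
    IsZero (groupCohomology (functions k G V) (n + 1)) :=
  groupCohomology.isZero_succ_of_retraction (functions k G V)
    { toFun (φ : G → G → V) x := φ x x
      map_add' _ _ := rfl
      map_smul' _ _ := rfl } (fun _ _ => rfl) (fun _ => rfl) n

theorem isZero_groupCohomology_res_functions (S : Subgroup G) (n : ℕ) :
    IsZero (groupCohomology (res S.subtype (functions k G V)) (n + 1)) := by
  obtain ⟨T, hT, -⟩ := S.exists_isComplement_right 1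
  refine groupCohomology.isZero_succ_of_retraction (res S.subtype (functions k G V))
    { toFun (φ : S → G → V) x := φ (hT.equiv x).1 x
      map_add' _ _ := rfl
      map_smul' _ _ := rfl } (fun g φ => ?_) (fun _ => rfl) n
  refine funext fun x => ?_
  change φ (g⁻¹ * (hT.equiv x).1) ((g : G)⁻¹ * x) =
    φ (hT.equiv ((g : G)⁻¹ * x)).1 ((g : G)⁻¹ * x)
  have := hT.equiv_mul_left g⁻¹ x
  rw [← Subgroup.coe_inv, this]

variable {k G V} in
theorem mem_invariants_functions_iff {S : Subgroup G} {φ : G → V} :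
    φ ∈ Representation.invariants ((functions k G V).ρ.comp S.subtype) ↔ ∀ s ∈ S, ∀ x, φ (s * x) = φ x := by
  refine ⟨fun h s hs x => ?_, fun h s => funext fun x => h _ (inv_mem s.2) x⟩
  simpa [functions_ρ_apply] using congrFun (h ⟨s⁻¹, inv_mem hs⟩) x

theorem isZero_groupCohomology_quotientToInvariants_functions (S : Subgroup G) [S.Normal]
    (n : ℕ) :
    IsZero (groupCohomology ((functions k G V).quotientToInvariants S) (n + 1)) := by
  refine groupCohomology.isZero_succ_of_retraction ((functions k G V).quotientToInvariants S)
    { toFun (φ : G ⧸ S → (functions k G V).quotientToInvariants S) := ⟨fun x => (φ x).1 x, mem_invariants_functions_iff.2 fun s hs x => ?_⟩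
      map_add' _ _ := rfl
      map_smul' _ _ := rfl } (fun g φ => ?_) (fun _ => rfl) n
  · have : ((s * x : G) : G ⧸ S) = x := by
      simp [(QuotientGroup.eq_one_iff s).2 hs]
    rw [this]
    exact mem_invariants_functions_iff.1 (φ x).2 s hs x
  · induction g using QuotientGroup.induction_on with | H g => rfl

end Functions

section DimensionShift

variable {k G : Type u} [CommRing k] [Group G] (M : Rep.{u} k G)

/-- The embedding of a representation into functions on the group, sending `m` to
`x ↦ x⁻¹ • m`. -/
noncomputable def toFunctions : M ⟶ functions k G M :=
  Rep.ofHom ⟨LinearMap.pi fun x => M.ρ x⁻¹, fun g => by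
    ext m x
    simp⟩

instance : Mono M.toFunctions :=
  (mono_iff_injective _).2 fun m₁ m₂ h => by
    simpa [toFunctions] using congrFun h 1

/-- The short exact sequence `0 ⟶ M ⟶ (G → M) ⟶ N ⟶ 0` used for dimension shifting. -/
noncomputable abbrev dimensionShift : ShortComplex (Rep.{u} k G) :=
  ShortComplex.mk M.toFunctions (cokernel.π M.toFunctions) (cokernel.condition _)

theorem dimensionShift_shortExact : M.dimensionShift.ShortExact where
  exact := ShortComplex.exact_cokernel _

end DimensionShift

section Invariants

variable {k G : Type u} [CommRing k] [Group G] (S : Subgroup G) [S.Normal]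

instance : (quotientToInvariantsFunctor.{u} k S).PreservesZeroMorphisms where

theorem shortExact_iff {H : Type u} [Group H] (X : ShortComplex (Rep.{u} k H)) :
    X.ShortExact ↔ Function.Injective X.f.hom ∧ Function.Surjective X.g.hom ∧
      ∀ y, X.g.hom y = 0 → ∃ x, X.f.hom x = y := by
  have key : X.Exact ↔ ∀ y, X.g.hom y = 0 → ∃ x, X.f.hom x = y := by
    rw [← ShortComplex.exact_map_iff_of_faithful X (forget₂ (Rep.{u} k H) (ModuleCat k)),
      ShortComplex.moduleCat_exact_iff]
    rfl
  rw [← mono_iff_injective, ← epi_iff_surjective, ← key]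
  exact ⟨fun h => ⟨h.2, h.3, h.1⟩, fun ⟨h₁, h₂, h₃⟩ => ⟨h₃⟩⟩

/-- Taking invariants under a normal subgroup `S` preserves exactness of a short exact sequence
whose first term has vanishing first cohomology over `S`. -/
theorem shortExact_map_quotientToInvariantsFunctor {X : ShortComplex (Rep.{u} k G)}
    (hX : X.ShortExact) (h : IsZero (groupCohomology (res S.subtype X.X₁) 1)) :
    (X.map (quotientToInvariantsFunctor k S)).ShortExact := by
  obtain ⟨hf, hg, hfg⟩ := (shortExact_iff X).1 hX
  have hgf (x) : X.g.hom (X.f.hom x) = 0 := congr($(X.zero).hom x)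
  refine (shortExact_iff _).2 ⟨fun x y hxy => Subtype.ext (hf congr(($hxy).1)), ?_, ?_⟩
  · rintro ⟨z, hz⟩
    obtain ⟨y, hy⟩ := hg z
    have hz' (s : S) : ∃ x, X.f.hom x = X.X₂.ρ s y - y := hfg _ <| by
      rw [map_sub, hom_comm_apply, hy, sub_eq_zero]
      exact hz s
    choose c hc using hz'
    have hcoc : c ∈ groupCohomology.cocycles₁ (res S.subtype X.X₁) := by
      rw [groupCohomology.mem_cocycles₁_iff]
      intro s t
      apply hf
      change X.f.hom _ = X.f.hom (X.X₁.ρ s (c t) + c s)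
      rw [map_add, hom_comm_apply, hc, hc, hc]
      simp
    have : Subsingleton (groupCohomology.H1 (res S.subtype X.X₁)) :=
      ModuleCat.subsingleton_of_isZero h
    obtain ⟨x, hx⟩ := (groupCohomology.H1π_eq_zero_iff (A := res S.subtype X.X₁) ⟨c, hcoc⟩).1 (Subsingleton.elim _ _)
    have hx' (s : S) : X.X₁.ρ s x - x = c s := congrFun hx s
    refine ⟨⟨y - X.f.hom x, fun s => ?_⟩, Subtype.ext ?_⟩
    · change X.X₂.ρ s (y - X.f.hom x) = y - X.f.hom x
      have := hc s
      rw [← hx', map_sub, hom_comm_apply] at this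
      rw [map_sub, sub_eq_sub_iff_sub_eq_sub, this]
    · change X.g.hom (y - X.f.hom x) = z
      rw [map_sub, hgf, hy, sub_zero]
  · rintro ⟨y, hy⟩ hy0
    obtain ⟨x, hx⟩ := hfg y congr(($hy0).1)
    refine ⟨⟨x, fun s => hf ?_⟩, Subtype.ext hx⟩
    change X.f.hom (X.X₁.ρ s x) = X.f.hom x
    rw [hom_comm_apply, hx]
    exact hy s

end Invariants

end Rep

namespace groupCohomology

open Rep

/-- Transporting a representation along a group isomorphism does not change its cohomology. -/
noncomputable def resIso {k G H : Type u} [CommRing k] [Group G] [Group H] (e : G ≃* H)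
    (M : Rep.{u} k G) (n : ℕ) :
    groupCohomology M n ≅ groupCohomology (res e.symm.toMonoidHom M) n :=
  mapIso e (LinearEquiv.refl k M) (fun g => LinearMap.ext fun m => by simp) n

section Extension

variable {k G : Type u} [CommRing k] [Group G] (S : Subgroup G) [S.Normal]

/-- Dimension shifting lowers the degree of cohomology over a subgroup by one. -/
theorem isZero_res_dimensionShift_X₃ (S : Subgroup G) (M : Rep.{u} k G) {n : ℕ}
    (h : IsZero (groupCohomology (res S.subtype M) (n + 2))) :
    IsZero (groupCohomology (res S.subtype M.dimensionShift.X₃) (n + 1)) :=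
  isZero_X₃ ((shortExact_res S.subtype).2 M.dimensionShift_shortExact) h
    (isZero_groupCohomology_res_functions k G M S n)

/-- If `M` is acyclic over the normal subgroup `S`, then its cohomology over `G` vanishes whenever
that of `M^S` over `G ⧸ S` does. -/
theorem isZero_of_isZero_quotientToInvariants (n : ℕ) : ∀ (M : Rep.{u} k G),
    (∀ i, IsZero (groupCohomology (res S.subtype M) (i + 1))) →
    IsZero (groupCohomology (M.quotientToInvariants S) (n + 1)) →
    IsZero (groupCohomology M (n + 1)) := by
  induction n with
  | zero =>
    intro M hM hQ
    exact (H1InfRes_exact M S).isZero_of_both_zeros (hQ.eq_of_src _ _) ((hM 0).eq_of_tgt _ _)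
  | succ n ih =>
    intro M hM hQ
    refine isZero_succ_X₁ M.dimensionShift_shortExact
      (isZero_groupCohomology_functions k G M (n + 1))
      (ih _ (fun i => isZero_res_dimensionShift_X₃ S M (hM (i + 1))) ?_)
    exact isZero_X₃
      (shortExact_map_quotientToInvariantsFunctor S M.dimensionShift_shortExact (hM 0)) hQ
      (isZero_groupCohomology_quotientToInvariants_functions k G M S n)

theorem isZero_of_isZero_res_of_isZero_quotient {q : ℕ}
    (hQ : ∀ (N : Rep.{u} k (G ⧸ S)) (n : ℕ), q < n → IsZero (groupCohomology N n))
    (p : ℕ) : ∀ (M : Rep.{u} k G),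
    (∀ n, p < n → IsZero (groupCohomology (res S.subtype M) n)) →
    ∀ n, p + q < n → IsZero (groupCohomology M n) := by
  induction p with
  | zero =>
    intro M hM n hn
    obtain ⟨n, rfl⟩ := Nat.exists_eq_add_one_of_ne_zero (by lia : n ≠ 0)
    exact isZero_of_isZero_quotientToInvariants S n M (fun i => hM _ (by lia))
      (hQ _ _ (by lia))
  | succ p ih =>
    intro M hM n hn
    obtain ⟨n, rfl⟩ := Nat.exists_eq_add_one_of_ne_zero (by lia : n ≠ 0)
    refine isZero_succ_X₁ M.dimensionShift_shortExact
      (isZero_groupCohomology_functions k G M n) (ih _ (fun i hi => ?_) n (by lia))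
    obtain ⟨i, rfl⟩ := Nat.exists_eq_add_one_of_ne_zero (by lia : i ≠ 0)
    exact isZero_res_dimensionShift_X₃ S M (hM _ (by lia))

end Extension

end groupCohomology

theorem cohDim_le_natCast_iff {G : Type} [Group G] {d : ℕ} :
    cohDim G ≤ d ↔ ∀ (M : Rep ℤ G) (n : ℕ), d < n → IsZero (groupCohomology M n) := by
  simp only [cohDim, sSup_le_iff, Set.forall_mem_image, Nat.cast_le, Set.mem_ofPred_eq,
    forall_exists_index, ModuleCat.isZero_iff_subsingleton, ← not_nontrivial_iff_subsingleton]
  exact ⟨fun h M n hn hM => hn.not_ge (h M hM), fun h n M hM => not_lt.1 fun hn => h M n hn hM⟩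

theorem cohDim_le_of_mulEquiv {G H : Type} [Group G] [Group H] (e : G ≃* H) :
    cohDim G ≤ cohDim H := by
  refine sSup_le_sSup (Set.image_mono ?_)
  rintro n ⟨M, hM⟩
  exact ⟨_, (groupCohomology.resIso e M n).toLinearEquiv.symm.toEquiv.nontrivial⟩

theorem cohDim_le_of_normal {G : Type} [Group G] (S : Subgroup G) [S.Normal] :
    cohDim G ≤ cohDim S + cohDim (G ⧸ S) := by
  cases hS : cohDim S using ENat.recTopCoe with
  | top => simp
  | coe p =>
    cases hQ : cohDim (G ⧸ S) using ENat.recTopCoe with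
    | top => simp
    | coe q =>
      rw [← Nat.cast_add, cohDim_le_natCast_iff]
      exact fun M => groupCohomology.isZero_of_isZero_res_of_isZero_quotient S
        (cohDim_le_natCast_iff.1 hQ.le) p M fun n => cohDim_le_natCast_iff.1 hS.le _ n

/-- If `1 → K → G → Q → 1` is a short exact sequence of groups, then
`cd(G) ≤ cd(K) + cd(Q)`. -/
theorem cohDim_le_of_shortExact {K G Q : Type} [Group K] [Group G] [Group Q]
    (ι : K →* G) (π : G →* Q) (hι : Function.Injective ι)
    (hπ : Function.Surjective π) (hexact : ι.range = π.ker) :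
    cohDim G ≤ cohDim K + cohDim Q := by
  exact (cohDim_le_of_normal π.ker).trans <| add_le_add
    (cohDim_le_of_mulEquiv ((MulEquiv.subgroupCongr hexact.symm).trans
      (MonoidHom.ofInjective hι).symm))
    (cohDim_le_of_mulEquiv (QuotientGroup.quotientKerEquivOfSurjective π hπ))
end

section
/- Let K and Q be Poincaré duality groups and let 1 → K → G → Q → 1 be a short exact sequence. Then G is a Poincaré duality group and cd(G) = cd(K) + cd(Q). -/
open CategoryTheory

/-- The trivial module `ℤ`, viewed as a module over the group ring `ℤ[G]`. -/
noncomputable def trivialGroupRingModule (G : Type) [Group G] :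
    ModuleCat (MonoidAlgebra ℤ G) :=
  (Rep.equivalenceModuleMonoidAlgebra.functor.obj (Rep.trivial ℤ G ℤ))

/-- `G` is of type `FP`: the trivial `ℤ[G]`-module `ℤ` admits a finite-length
projective resolution by finitely generated `ℤ[G]`-modules. -/
def IsFP (G : Type) [Group G] : Prop :=
  ∃ (res : ProjectiveResolution (trivialGroupRingModule G)) (m : ℕ),
    (∀ i : ℕ, Module.Finite (MonoidAlgebra ℤ G) (res.complex.X i)) ∧
    (∀ i : ℕ, m < i → Subsingleton (res.complex.X i))

/-- A group `Γ` is a Poincaré duality group if the trivial `ℤΓ`-module `ℤ` admits a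
finite-length projective resolution by finitely generated `ℤΓ`-modules, and
`H^i(Γ, ℤΓ)` is trivial in all but one dimension, where it is (group) isomorphic
to `ℤ`. -/
def IsPoincareDualityGroup (G : Type) [Group G] : Prop :=
  IsFP G ∧ ∃ n : ℕ,
    (∀ i : ℕ, i ≠ n → Subsingleton (groupCohomology (Rep.leftRegular ℤ G) i)) ∧
    Nonempty ((groupCohomology (Rep.leftRegular ℤ G) n) ≃+ ℤ)

section FiniteResolutions

variable {R : Type} [Ring R]

/-- `M` has a resolution of length `n` by finitely generated projective modules. -/
def HasFiniteResolution (R : Type) [Ring R] :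
    ℕ → ∀ (M : Type) [AddCommGroup M] [Module R M], Prop
  | 0, M, _, _ => Module.Finite R M ∧ Module.Projective R M
  | n + 1, M, _, _ => ∃ (P : Type) (_ : AddCommGroup P) (_ : Module R P) (f : P →ₗ[R] M),
      Module.Finite R P ∧ Module.Projective R P ∧ Function.Surjective f ∧
        HasFiniteResolution R n (LinearMap.ker f)

namespace HasFiniteResolution

theorem congr {n : ℕ} : ∀ {M N : Type} [AddCommGroup M] [Module R M] [AddCommGroup N] [Module R N]
    (_ : M ≃ₗ[R] N) (_ : HasFiniteResolution R n M), HasFiniteResolution R n N := by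
  induction n with
  | zero =>
    intro M N _ _ _ _ e ⟨h1, h2⟩
    exact ⟨Module.Finite.equiv e, Module.Projective.of_equiv e⟩
  | succ n ih =>
    intro M N _ _ _ _ e ⟨P, _, _, f, h1, h2, h3, h4⟩
    refine ⟨P, _, _, e.toLinearMap ∘ₗ f, h1, h2, e.surjective.comp h3, ?_⟩
    refine ih (LinearEquiv.ofEq _ _ ?_) h4
    ext x; simp

/-- The comparison isomorphism in Schanuel's lemma. -/
theorem schanuel {M P P' : Type} [AddCommGroup M] [Module R M] [AddCommGroup P] [Module R P]
    [AddCommGroup P'] [Module R P'] [Module.Projective R P] [Module.Projective R P']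
    (f : P →ₗ[R] M) (g : P' →ₗ[R] M) (hf : Function.Surjective f) (hg : Function.Surjective g) :
    Nonempty ((LinearMap.ker f × P') ≃ₗ[R] (LinearMap.ker g × P)) := by
  obtain ⟨a, ha⟩ := Module.projective_lifting_property f g hf
  obtain ⟨b, hb⟩ := Module.projective_lifting_property g f hg
  have ha' : ∀ x, f (a x) = g x := fun x => LinearMap.congr_fun ha x
  have hb' : ∀ x, g (b x) = f x := fun x => LinearMap.congr_fun hb x
  refine ⟨{ toFun := fun x => (⟨x.2 - b (x.1 + a x.2), ?_⟩, x.1 + a x.2)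
            invFun := fun y => (⟨y.2 - a (y.1 + b y.2), ?_⟩, y.1 + b y.2)
            map_add' := ?_
            map_smul' := ?_
            left_inv := ?_
            right_inv := ?_ }⟩
  · simp [LinearMap.mem_ker, ha', hb']
  · intro x y
    ext <;> simp <;> abel
  · intro r x
    ext <;> simp [smul_sub, smul_add]
  · simp [LinearMap.mem_ker, ha', hb']
  · intro x
    ext <;> simp
  · intro x
    ext <;> simp

theorem prod_projective {n : ℕ} : ∀ {M P : Type} [AddCommGroup M] [Module R M] [AddCommGroup P]
    [Module R P] [Module.Finite R P] [Module.Projective R P]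
    (_ : HasFiniteResolution R n M), HasFiniteResolution R n (M × P) := by
  cases n with
  | zero =>
    intro M N _ _ _ _ _ _ ⟨h1, h2⟩
    exact ⟨inferInstance, inferInstance⟩
  | succ n =>
    intro M N _ _ _ _ _ _ ⟨P, _, _, f, h1, h2, h3, h4⟩
    refine ⟨P × N, _, _, f.prodMap LinearMap.id, inferInstance, inferInstance,
      h3.prodMap Function.surjective_id, ?_⟩
    refine congr (M := LinearMap.ker f) ?_ h4
    exact
      { toFun := fun x => ⟨(x.1, 0), by simp⟩
        invFun := fun x => ⟨x.1.1, by have := x.2; simp [LinearMap.mem_ker] at this; exact this.1⟩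
        map_add' := by intro x y; ext <;> simp
        map_smul' := by intro x y; ext <;> simp
        left_inv := by intro x; ext; simp
        right_inv := by
          intro x
          have := x.2; simp [LinearMap.mem_ker] at this
          ext <;> simp [this] }

theorem finite {n : ℕ} {M : Type} [AddCommGroup M] [Module R M]
    (h : HasFiniteResolution R n M) : Module.Finite R M := by
  cases n with
  | zero => exact h.1
  | succ n =>
    obtain ⟨P, _, _, f, h1, h2, h3, h4⟩ := h
    exact Module.Finite.of_surjective f h3

theorem fst {n : ℕ} : ∀ {M N : Type} [AddCommGroup M] [Module R M] [AddCommGroup N]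
    [Module R N] (_ : HasFiniteResolution R n (M × N)), HasFiniteResolution R n M := by
  induction n with
  | zero =>
    intro M N _ _ _ _ ⟨h1, h2⟩
    exact ⟨Module.Finite.of_surjective (LinearMap.fst R M N) Prod.fst_surjective,
      Module.Projective.of_split (LinearMap.inl R M N) (LinearMap.fst R M N) (by ext; simp)⟩
  | succ n ih =>
    intro M N _ _ _ _ ⟨P, _, _, f, h1, h2, h3, h4⟩
    let fM := LinearMap.fst R M N ∘ₗ f
    let fN := LinearMap.snd R M N ∘ₗ f
    have hM : Function.Surjective fM := Prod.fst_surjective.comp h3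
    have hN : Function.Surjective fN := Prod.snd_surjective.comp h3
    obtain ⟨e⟩ := schanuel f (fM.prodMap fN) h3 (hM.prodMap hN)
    refine ⟨P, _, _, fM, h1, h2, hM, ?_⟩
    have h5 := congr e (prod_projective (P := P × P) h4)
    have e2 : LinearMap.ker (fM.prodMap fN) ≃ₗ[R] LinearMap.ker fM × LinearMap.ker fN :=
      { toFun := fun x => (⟨x.1.1, by
            have := x.2; rw [LinearMap.mem_ker, Prod.ext_iff] at this; exact this.1⟩,
          ⟨x.1.2, by have := x.2; rw [LinearMap.mem_ker, Prod.ext_iff] at this; exact this.2⟩)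
        invFun := fun x => ⟨(x.1.1, x.2.1), by
          have h1 := x.1.2
          have h2 := x.2.2
          rw [LinearMap.mem_ker] at h1 h2 ⊢
          exact Prod.ext h1 h2⟩
        map_add' := by intro x y; ext <;> simp
        map_smul' := by intro x y; ext <;> simp
        left_inv := by intro x; ext <;> simp
        right_inv := by intro x; ext <;> simp }
    exact ih
      (congr ((e2.prodCongr (LinearEquiv.refl R P)).trans (LinearEquiv.prodAssoc R _ _ _)) h5)

theorem succ {n : ℕ} : ∀ {M : Type} [AddCommGroup M] [Module R M]
    (_ : HasFiniteResolution R n M), HasFiniteResolution R (n + 1) M := by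
  induction n with
  | zero =>
    intro M _ _ ⟨h1, h2⟩
    refine ⟨M, _, _, LinearMap.id, h1, h2, Function.surjective_id, ?_⟩
    rw [LinearMap.ker_id]
    exact ⟨inferInstance, inferInstance⟩
  | succ n ih =>
    intro M _ _ ⟨P, _, _, f, h1, h2, h3, h4⟩
    exact ⟨P, _, _, f, h1, h2, h3, ih h4⟩

theorem mono {n m : ℕ} (hnm : n ≤ m) {M : Type} [AddCommGroup M] [Module R M]
    (h : HasFiniteResolution R n M) : HasFiniteResolution R m M := by
  induction hnm with
  | refl => exact h
  | step _ ih => exact ih.succ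

theorem extension {n : ℕ} : ∀ {A B C : Type} [AddCommGroup A] [Module R A] [AddCommGroup B]
    [Module R B] [AddCommGroup C] [Module R C] (i : A →ₗ[R] B) (p : B →ₗ[R] C)
    (_ : Function.Injective i) (_ : Function.Surjective p) (_ : Function.Exact i p)
    (_ : HasFiniteResolution R n A) (_ : HasFiniteResolution R n C),
    HasFiniteResolution R n B := by
  induction n with
  | zero =>
    intro A B C _ _ _ _ _ _ i p hi hp hip ⟨_, _⟩ ⟨_, _⟩
    obtain ⟨s, hs⟩ := Module.projective_lifting_property p LinearMap.id hp
    have := (hip.splitSurjectiveEquiv hi ⟨s, hs⟩).1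
    exact ⟨Module.Finite.equiv this.symm, Module.Projective.of_equiv this.symm⟩
  | succ n ih =>
    intro A B C _ _ _ _ _ _ i p hi hp hip ⟨P, _, _, f, _, _, hf, hf'⟩ ⟨P', _, _, g, _, _, hg, hg'⟩
    obtain ⟨g', hg1⟩ := Module.projective_lifting_property p g hp
    have hg1 : ∀ x, p (g' x) = g x := fun x => LinearMap.congr_fun hg1 x
    have hpi : ∀ x, p (i x) = 0 := fun x => hip.apply_apply_eq_zero x
    let k : P × P' →ₗ[R] B := (i ∘ₗ f).coprod g'
    have hk : ∀ x, k x = i (f x.1) + g' x.2 := fun x => by simp [k]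
    refine ⟨P × P', _, _, k, inferInstance, inferInstance, ?_, ?_⟩
    · intro b
      obtain ⟨y, hy⟩ := hg (p b)
      obtain ⟨a, ha⟩ := (hip (b - g' y)).1 (by rw [map_sub, hg1, hy, sub_self])
      obtain ⟨x, rfl⟩ := hf a
      exact ⟨(x, y), by rw [hk, ha]; simp⟩
    · have h2 : ∀ x : LinearMap.ker k, g x.1.2 = 0 := by
        intro x
        have := congrArg p ((hk x).symm.trans x.2)
        rwa [map_add, hpi, hg1, zero_add, map_zero] at this
      refine ih (A := LinearMap.ker f) (C := LinearMap.ker g)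
        ((LinearMap.inl R P P' ∘ₗ (LinearMap.ker f).subtype).codRestrict _ ?_)
        ((LinearMap.snd R P P' ∘ₗ (LinearMap.ker k).subtype).codRestrict _ ?_) ?_ ?_ ?_ hf' hg'
      · intro x
        rw [LinearMap.mem_ker, hk]
        simp
      · intro x
        simpa using h2 x
      · intro x y h
        exact Subtype.ext (congrArg (fun z => z.1.1) h)
      · rintro ⟨y, hy⟩
        obtain ⟨a, ha⟩ := (hip (g' y)).1 (by rw [hg1]; exact hy)
        obtain ⟨x, rfl⟩ := hf a
        refine ⟨⟨(-x, y), ?_⟩, ?_⟩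
        · rw [LinearMap.mem_ker, hk]; simp [ha]
        · rfl
      · rintro ⟨⟨x, y⟩, hxy⟩
        constructor
        · intro h
          have hy : y = 0 := congrArg Subtype.val h
          subst hy
          have hx : i (f x) = i 0 := by
            simpa [hk] using hxy
          exact ⟨⟨x, hi hx⟩, rfl⟩
        · rintro ⟨z, hz⟩
          rw [← hz]
          rfl

theorem quotient {n : ℕ} {A B C : Type} [AddCommGroup A] [Module R A] [AddCommGroup B]
    [Module R B] [AddCommGroup C] [Module R C] (i : A →ₗ[R] B) (p : B →ₗ[R] C)
    (hi : Function.Injective i) (hp : Function.Surjective p) (hip : Function.Exact i p)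
    (hA : HasFiniteResolution R n A) (hB : HasFiniteResolution R n B) :
    HasFiniteResolution R (n + 1) C := by
  obtain ⟨P, _, _, f, h1, h2, h3, h4⟩ := hB.succ
  refine ⟨P, _, _, p ∘ₗ f, h1, h2, hp.comp h3, ?_⟩
  have h5 : ∀ x : LinearMap.ker (p ∘ₗ f), f x ∈ LinearMap.range i := fun x => (hip _).1 x.2
  let e := LinearEquiv.ofInjective i hi
  let q : LinearMap.ker (p ∘ₗ f) →ₗ[R] LinearMap.range i :=
    (f ∘ₗ (LinearMap.ker (p ∘ₗ f)).subtype).codRestrict _ h5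
  refine extension (A := LinearMap.ker f) (C := LinearMap.range i)
    (Submodule.inclusion (fun x hx => ?_)) q (Submodule.inclusion_injective _) ?_ ?_ h4
    (congr e hA)
  · rw [LinearMap.mem_ker] at hx ⊢; simp [hx]
  · rintro ⟨_, a, rfl⟩
    obtain ⟨x, hx⟩ := h3 (i a)
    exact ⟨⟨x, by simp [hx, hip.apply_apply_eq_zero]⟩, Subtype.ext hx⟩
  · rintro ⟨x, hx⟩
    constructor
    · intro h
      exact ⟨⟨x, congrArg Subtype.val h⟩, rfl⟩
    · rintro ⟨z, hz⟩
      rw [← hz]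
      exact Subtype.ext z.2

end HasFiniteResolution

end FiniteResolutions

section ProjectiveResolutions

variable {R : Type} [Ring R]

theorem HasFiniteResolution.of_projectiveResolution {M : ModuleCat.{0} R}
    (P : ProjectiveResolution M) (m : ℕ) (hfin : ∀ i, Module.Finite R (P.complex.X i))
    (hzero : ∀ i, m < i → Subsingleton (P.complex.X i)) :
    HasFiniteResolution R (m + 1) M := by
  have hproj : ∀ i, Module.Projective R (P.complex.X i) := fun i =>
    (IsProjective.iff_projective _).2 (P.projective i)
  have key : ∀ j i, m ≤ i + j →
      HasFiniteResolution R j (LinearMap.range (P.complex.d (i + 1) i).hom) := by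
    intro j
    induction j with
    | zero =>
      intro i hi
      have := hzero (i + 1) (by omega)
      have : Subsingleton (LinearMap.range (P.complex.d (i + 1) i).hom) :=
        (LinearMap.surjective_rangeRestrict (P.complex.d (i + 1) i).hom).subsingleton
      exact ⟨inferInstance, inferInstance⟩
    | succ j ih =>
      intro i hi
      refine ⟨P.complex.X (i + 1), _, _, (P.complex.d (i + 1) i).hom.rangeRestrict, hfin _,
        hproj _, LinearMap.surjective_rangeRestrict _, ?_⟩
      refine (ih (i + 1) (by omega)).congr (LinearEquiv.ofEq _ _ ?_)
      rw [LinearMap.ker_rangeRestrict]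
      exact (ShortComplex.moduleCat_exact_iff_range_eq_ker _).1 (P.exact_succ i)
  have hex : (ShortComplex.mk _ _ P.complex_d_comp_π_f_zero).Exact :=
    ShortComplex.exact_of_g_is_cokernel _ P.isColimitCokernelCofork
  refine ⟨P.complex.X 0, _, _, (P.π.f 0).hom, hfin _, hproj _,
    (ModuleCat.epi_iff_surjective _).1 inferInstance, ?_⟩
  refine (key m 0 (by omega)).congr (LinearEquiv.ofEq _ _ ?_)
  exact (ShortComplex.moduleCat_exact_iff_range_eq_ker _).1 hex

theorem HasFiniteResolution.exists_projectiveResolution {n : ℕ} :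
    ∀ {M : Type} [AddCommGroup M] [Module R M] (_ : HasFiniteResolution R n M),
    ∃ (P : ProjectiveResolution (ModuleCat.of R M)) (m : ℕ),
      (∀ i, Module.Finite R (P.complex.X i)) ∧
      (∀ i, m < i → Subsingleton (P.complex.X i)) := by
  induction n with
  | zero =>
    intro M _ _ ⟨h1, h2⟩
    have : Projective (ModuleCat.of R M) := (IsProjective.iff_projective _).1 h2
    have h0 : ∀ i,
        Subsingleton ((ProjectiveResolution.self (ModuleCat.of R M)).complex.X (i + 1)) := by
      intro i
      refine ModuleCat.subsingleton_of_isZero ?_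
      exact HomologicalComplex.isZero_single_obj_X _ _ _ _ (by simp)
    refine ⟨ProjectiveResolution.self _, 0, ?_, ?_⟩
    · intro i
      cases i with
      | zero => exact h1
      | succ i =>
        have := h0 i
        infer_instance
    · intro i hi
      obtain ⟨i, rfl⟩ := Nat.exists_eq_succ_of_ne_zero hi.ne'
      exact h0 i
  | succ n ih =>
    intro M _ _ ⟨P, _, _, f, h1, h2, h3, h4⟩
    obtain ⟨C, m, hC1, hC2⟩ := ih h4
    have hP : Projective (ModuleCat.of R P) := (IsProjective.iff_projective _).1 h2
    have hCex : (ShortComplex.mk _ _ C.complex_d_comp_π_f_zero).Exact :=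
      ShortComplex.exact_of_g_is_cokernel _ C.isColimitCokernelCofork
    let k : C.complex.X 0 ⟶ ModuleCat.of R P :=
      C.π.f 0 ≫ ModuleCat.ofHom (LinearMap.ker f).subtype
    have hkf : k ≫ ModuleCat.ofHom f = 0 := by
      ext x
      exact (C.π.f 0 x).2
    have hk : C.complex.d 1 0 ≫ k = 0 := by
      ext x
      exact congrArg Subtype.val (ConcreteCategory.congr_hom C.complex_d_comp_π_f_zero x)
    have hkex : (ShortComplex.mk k (ModuleCat.ofHom f) hkf).Exact := by
      rw [ShortComplex.moduleCat_exact_iff]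
      intro x hx
      obtain ⟨y, hy⟩ := (ModuleCat.epi_iff_surjective (C.π.f 0)).1 inferInstance ⟨x, hx⟩
      exact ⟨y, congrArg Subtype.val hy⟩
    have hdkex : (ShortComplex.mk (C.complex.d 1 0) k hk).Exact := by
      rw [ShortComplex.moduleCat_exact_iff] at hCex ⊢
      intro x hx
      exact hCex x (Subtype.ext hx)
    let D := C.complex.augment k hk
    have hDproj : ∀ i, Projective (D.X i) := by
      rintro (_ | i)
      · exact hP
      · exact C.projective i
    have hDex : ∀ i, D.ExactAt (i + 1) := by
      intro i
      rw [HomologicalComplex.exactAt_iff' _ (i + 1 + 1) (i + 1) i (by simp) (by simp)]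
      cases i with
      | zero => exact hdkex
      | succ i => exact C.exact_succ i
    let π : D ⟶ (ChainComplex.single₀ _).obj (ModuleCat.of R M) :=
      (ChainComplex.toSingle₀Equiv _ _).symm ⟨ModuleCat.ofHom f, hkf⟩
    have hπ : QuasiIso π := ⟨fun i => by
      cases i with
      | zero =>
        rw [ChainComplex.quasiIsoAt₀_iff, ShortComplex.quasiIso_iff_of_zeros']
        · refine (ShortComplex.exact_and_epi_g_iff_of_iso ?_).2
            ⟨hkex, (ModuleCat.epi_iff_surjective _).2 h3⟩
          refine ShortComplex.isoMk (Iso.refl _) (Iso.refl _) (Iso.refl _) ?_ ?_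
          · exact (Category.id_comp _).trans (Category.comp_id _).symm
          · refine (Category.id_comp _).trans (Eq.trans ?_ (Category.comp_id _).symm)
            exact (ChainComplex.toSingle₀Equiv_symm_apply_f_zero (C := D) (X := ModuleCat.of R M)
              (ModuleCat.ofHom f) hkf).symm
        all_goals rfl
      | succ i =>
        rw [quasiIsoAt_iff_exactAt']
        · exact hDex i
        · apply ChainComplex.exactAt_succ_single_obj⟩
    refine ⟨{ complex := D, projective := hDproj, π := π, quasiIso := hπ }, m + 1, ?_, ?_⟩
    · rintro (_ | i)
      · exact h1
      · exact hC1 i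
    · rintro (_ | i) hi
      · omega
      · exact hC2 i (by omega)

theorem isFP_iff_hasFiniteResolution (G : Type) [Group G] :
    IsFP G ↔ ∃ n, HasFiniteResolution (MonoidAlgebra ℤ G) n (trivialGroupRingModule G) := by
  constructor
  · rintro ⟨P, m, h1, h2⟩
    exact ⟨m + 1, .of_projectiveResolution P m h1 h2⟩
  · rintro ⟨n, h⟩
    exact h.exists_projectiveResolution

end ProjectiveResolutions

section GroupCohomologyExt

/-- Two surjections with the same kernel have isomorphic targets. -/
theorem nonempty_addEquiv_of_surjective {A B C : Type*} [AddCommGroup A] [AddCommGroup B]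
    [AddCommGroup C] (f : A →+ B) (g : A →+ C) (hf : Function.Surjective f)
    (hg : Function.Surjective g) (h : ∀ x, f x = 0 ↔ g x = 0) : Nonempty (B ≃+ C) := by
  have hk : f.ker = g.ker := by ext x; exact h x
  exact ⟨(QuotientAddGroup.quotientKerEquivOfSurjective f hf).symm.trans
    ((QuotientAddGroup.quotientAddEquivOfEq hk).trans
      (QuotientAddGroup.quotientKerEquivOfSurjective g hg))⟩

theorem exists_surjective_homology {k : Type} [Ring k] (S : ShortComplex (ModuleCat.{0} k)) :
    ∃ f : LinearMap.ker S.g.hom →+ S.homology, Function.Surjective f ∧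
      ∀ x, f x = 0 ↔ ∃ y, S.f y = x.1 := by
  let e := S.moduleCatHomologyIso.toLinearEquiv
  refine ⟨(e.symm.toLinearMap ∘ₗ
    (LinearMap.range S.moduleCatToCycles).mkQ).toAddMonoidHom, ?_, ?_⟩
  · exact e.symm.surjective.comp (Submodule.mkQ_surjective _)
  · intro x
    change e.symm _ = 0 ↔ _
    rw [LinearEquiv.map_eq_zero_iff]
    refine (Submodule.Quotient.mk_eq_zero (LinearMap.range S.moduleCatToCycles)).trans ?_
    constructor
    · rintro ⟨y, hy⟩
      exact ⟨y, congrArg Subtype.val hy⟩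
    · rintro ⟨y, hy⟩
      exact ⟨y, Subtype.ext hy⟩

universe v u

variable {C : Type u} [Category.{0} C] [Abelian C] [lin : Linear ℤ C] [HasExt.{v} C]

theorem nonempty_homology_linearYonedaObj_addEquiv {X : C} (P : ProjectiveResolution X) (Y : C)
    (n : ℕ) : Nonempty ((P.complex.linearYonedaObj ℤ Y).homology n ≃+ Abelian.Ext X Y n) := by
  cases n with
  | zero =>
    let S := (P.complex.linearYonedaObj ℤ Y).sc' 0 0 1
    obtain ⟨f, hf, hf'⟩ := exists_surjective_homology S
    have e0 : (P.complex.linearYonedaObj ℤ Y).homology 0 ≅ S.homology :=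
      ShortComplex.homologyMapIso
        ((P.complex.linearYonedaObj ℤ Y).isoSc' 0 0 1 (by simp) (by simp))
    have key : ∀ g : P.complex.X 0 ⟶ Y, P.complex.d 1 0 ≫ g = 0 →
        ∃ h : X ⟶ Y, P.π.f 0 ≫ h = g := fun g hg =>
      ⟨P.isColimitCokernelCofork.desc (Limits.CokernelCofork.ofπ g hg),
        P.isColimitCokernelCofork.fac _ Limits.WalkingParallelPair.one⟩
    let p : (X ⟶ Y) →+ LinearMap.ker S.g.hom :=
      { toFun := fun h => ⟨P.π.f 0 ≫ h, by
          exact (P.complex_d_comp_π_f_zero_assoc h).trans Limits.zero_comp⟩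
        map_zero' := Subtype.ext Limits.comp_zero
        map_add' := fun x y => Subtype.ext (Preadditive.comp_add _ _ _ _ _ _) }
    have hp : Function.Surjective p := fun g => by
      obtain ⟨h, hh⟩ := key g.1 g.2
      exact ⟨h, Subtype.ext hh⟩
    obtain ⟨e⟩ := nonempty_addEquiv_of_surjective (f.comp p) (AddMonoidHom.id _) (hf.comp hp)
        Function.surjective_id (by
      intro h
      rw [AddMonoidHom.comp_apply, hf']
      have hS : S.f = 0 :=
        (P.complex.linearYonedaObj ℤ Y).shape 0 0 (fun h => Nat.succ_ne_zero 0 h)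
      constructor
      · rintro ⟨y, hy⟩
        rw [hS] at hy
        have h0 : P.π.f 0 ≫ h = 0 := hy.symm
        have : Epi (P.π.f 0) := inferInstance
        exact this.left_cancellation _ _ (h0.trans Limits.comp_zero.symm)
      · intro hh
        have hh : h = 0 := hh
        refine ⟨0, ?_⟩
        rw [map_zero, hh, map_zero]
        rfl)
    exact ⟨e0.toLinearEquiv.toAddEquiv.trans (e.trans Abelian.Ext.addEquiv₀.symm)⟩
  | succ n =>
    let S := (P.complex.linearYonedaObj ℤ Y).sc' n (n + 1) (n + 2)
    obtain ⟨f, hf, hf'⟩ := exists_surjective_homology S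
    have e0 : (P.complex.linearYonedaObj ℤ Y).homology (n + 1) ≅ S.homology :=
      ShortComplex.homologyMapIso
        ((P.complex.linearYonedaObj ℤ Y).isoSc' n (n + 1) (n + 2) (by simp) (by simp))
    let g : LinearMap.ker S.g.hom →+ Abelian.Ext X Y (n + 1) :=
      { toFun := fun x => P.extMk (n := n + 1) x.1 (n + 2) rfl x.2
        map_zero' := P.extMk_zero _ _
        map_add' := fun x y => (P.add_extMk _ _ _ _ _ _).symm }
    obtain ⟨e⟩ := nonempty_addEquiv_of_surjective f g hf (by
      intro e
      obtain ⟨x, hx, rfl⟩ := P.extMk_surjective e (n + 2) rfl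
      exact ⟨⟨x, hx⟩, rfl⟩) (by
      intro x
      rw [hf']
      exact (P.extMk_eq_zero_iff (n := n + 1) x.1 (n + 2) rfl x.2 n rfl).symm)
    exact ⟨e0.toLinearEquiv.toAddEquiv.trans e⟩

/-- Group cohomology as `Ext` over the group ring. -/
theorem nonempty_groupCohomology_addEquiv_ext {G : Type} [Group G] (A : Rep ℤ G) (n : ℕ) :
    Nonempty (groupCohomology A n ≃+ Abelian.Ext (trivialGroupRingModule G)
      (Rep.equivalenceModuleMonoidAlgebra.functor.obj A) n) := by
  have : HasExt.{0} (Rep.{0} ℤ G) := hasExt_of_enoughProjectives _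
  obtain ⟨e⟩ := nonempty_homology_linearYonedaObj_addEquiv (lin := Rep.instLinear)
    (Rep.barResolution ℤ G) A n
  let F : Rep.{0} ℤ G ⥤ ModuleCat (MonoidAlgebra ℤ G) :=
    Rep.equivalenceModuleMonoidAlgebra.functor
  have : F.Additive := Functor.additive_of_preserves_binary_products F
  have hb := Functor.mapExt_bijective_of_preservesProjectiveObjects F (Rep.trivial ℤ G ℤ) A n
  exact ⟨(groupCohomologyIso A n (Rep.barResolution ℤ G)).toLinearEquiv.toAddEquiv.trans
    (e.trans (AddEquiv.ofBijective _ hb))⟩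

theorem nonempty_iso_leftRegular (G : Type) [Group G] :
    Nonempty (Rep.equivalenceModuleMonoidAlgebra.functor.obj (Rep.leftRegular ℤ G) ≅
      ModuleCat.of (MonoidAlgebra ℤ G) (MonoidAlgebra ℤ G)) := by
  exact ⟨(Representation.ofMulActionSelfAsModuleEquiv (k := ℤ) (G := G)).toModuleIso⟩

end GroupCohomologyExt

section ExtFunctoriality

open Abelian

universe w w' v v' u u'

variable {C : Type u} [Category.{v} C] [Abelian C] [HasExt.{w} C]

/-- Precomposition with a morphism, on `Ext` groups. -/
noncomputable def extPre {X X' : C} (f : X' ⟶ X) (Y : C) (n : ℕ) : Ext X Y n →+ Ext X' Y n :=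
  (Ext.mk₀ f).precomp Y (zero_add n)

/-- Postcomposition with a morphism, on `Ext` groups. -/
noncomputable def extPost (X : C) {Y Y' : C} (g : Y ⟶ Y') (n : ℕ) : Ext X Y n →+ Ext X Y' n :=
  (Ext.mk₀ g).postcomp X (add_zero n)

/-- The contravariant connecting homomorphism. -/
noncomputable def extδ {S : ShortComplex C} (hS : S.ShortExact) (Y : C) (n : ℕ) :
    Ext S.X₁ Y n →+ Ext S.X₃ Y (n + 1) :=
  hS.extClass.precomp Y (add_comm 1 n)

theorem extPre_apply {X X' Y : C} (f : X' ⟶ X) {n : ℕ} (e : Ext X Y n) :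
    extPre f Y n e = (Ext.mk₀ f).comp e (zero_add n) := rfl

theorem extPost_apply {X Y Y' : C} (g : Y ⟶ Y') {n : ℕ} (e : Ext X Y n) :
    extPost X g n e = e.comp (Ext.mk₀ g) (add_zero n) := rfl

theorem extδ_apply {S : ShortComplex C} (hS : S.ShortExact) {Y : C} {n : ℕ} (e : Ext S.X₁ Y n) :
    extδ hS Y n e = hS.extClass.comp e (add_comm 1 n) := rfl

@[simp]
theorem extPre_mk₀ {X X' Y : C} (f : X' ⟶ X) (g : X ⟶ Y) :
    extPre f Y 0 (Ext.mk₀ g) = Ext.mk₀ (f ≫ g) := by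
  rw [extPre_apply, Ext.mk₀_comp_mk₀]

@[simp]
theorem extPost_mk₀ {X Y Y' : C} (f : X ⟶ Y) (g : Y ⟶ Y') :
    extPost X g 0 (Ext.mk₀ f) = Ext.mk₀ (f ≫ g) := by
  rw [extPost_apply, Ext.mk₀_comp_mk₀]

@[simp]
theorem extPre_id {X Y : C} {n : ℕ} (e : Ext X Y n) : extPre (𝟙 X) Y n e = e := by
  rw [extPre_apply, Ext.mk₀_id_comp]

@[simp]
theorem extPost_id {X Y : C} {n : ℕ} (e : Ext X Y n) : extPost X (𝟙 Y) n e = e := by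
  rw [extPost_apply, Ext.comp_mk₀_id]

theorem extPre_comp {X X' X'' Y : C} (f : X' ⟶ X) (g : X'' ⟶ X') {n : ℕ} (e : Ext X Y n) :
    extPre (g ≫ f) Y n e = extPre g Y n (extPre f Y n e) := by
  simp only [extPre_apply, Ext.mk₀_comp_mk₀_assoc]

theorem extPost_comp {X Y Y' Y'' : C} (f : Y ⟶ Y') (g : Y' ⟶ Y'') {n : ℕ} (e : Ext X Y n) :
    extPost X (f ≫ g) n e = extPost X g n (extPost X f n e) := by
  simp only [extPost_apply, Ext.comp_assoc_of_second_deg_zero, Ext.mk₀_comp_mk₀]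

@[simp]
theorem extPre_zero {X X' Y : C} {n : ℕ} (e : Ext X Y n) :
    extPre (0 : X' ⟶ X) Y n e = 0 := by
  rw [extPre_apply, Ext.mk₀_zero, Ext.zero_comp]

@[simp]
theorem extPost_zero {X Y Y' : C} {n : ℕ} (e : Ext X Y n) :
    extPost X (0 : Y ⟶ Y') n e = 0 := by
  rw [extPost_apply, Ext.mk₀_zero, Ext.comp_zero]

theorem extPre_add {X X' Y : C} (f g : X' ⟶ X) {n : ℕ} (e : Ext X Y n) :
    extPre (f + g) Y n e = extPre f Y n e + extPre g Y n e := by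
  rw [extPre_apply, Ext.mk₀_add, Ext.add_comp]; rfl

theorem extPost_add {X Y Y' : C} (f g : Y ⟶ Y') {n : ℕ} (e : Ext X Y n) :
    extPost X (f + g) n e = extPost X f n e + extPost X g n e := by
  rw [extPost_apply, Ext.mk₀_add, Ext.comp_add]; rfl

theorem extPre_sum {X X' Y : C} {ι : Type*} (s : Finset ι) (f : ι → (X' ⟶ X)) {n : ℕ}
    (e : Ext X Y n) : extPre (∑ i ∈ s, f i) Y n e = ∑ i ∈ s, extPre (f i) Y n e := by
  classical
  induction s using Finset.induction_on with
  | empty => simp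
  | insert a s ha ih => rw [Finset.sum_insert ha, Finset.sum_insert ha, extPre_add, ih]

theorem extPost_sum {X Y Y' : C} {ι : Type*} (s : Finset ι) (f : ι → (Y ⟶ Y')) {n : ℕ}
    (e : Ext X Y n) : extPost X (∑ i ∈ s, f i) n e = ∑ i ∈ s, extPost X (f i) n e := by
  classical
  induction s using Finset.induction_on with
  | empty => simp
  | insert a s ha ih => rw [Finset.sum_insert ha, Finset.sum_insert ha, extPost_add, ih]

theorem extPre_extPost {X X' Y Y' : C} (f : X' ⟶ X) (g : Y ⟶ Y') {n : ℕ} (e : Ext X Y n) :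
    extPre f Y' n (extPost X g n e) = extPost X' g n (extPre f Y n e) := by
  simp only [extPre_apply, extPost_apply, Ext.comp_assoc_of_third_deg_zero]

theorem extδ_extPost {S : ShortComplex C} (hS : S.ShortExact) {Y Y' : C} (g : Y ⟶ Y') {n : ℕ}
    (e : Ext S.X₁ Y n) : extδ hS Y' n (extPost S.X₁ g n e) =
      extPost S.X₃ g (n + 1) (extδ hS Y n e) := by
  simp only [extδ_apply, extPost_apply, Ext.comp_assoc_of_third_deg_zero]

theorem extδ_naturality {S T : ShortComplex C} (hS : S.ShortExact) (hT : T.ShortExact)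
    (φ : S ⟶ T) {Y : C} {n : ℕ} (e : Ext T.X₁ Y n) :
    extPre φ.τ₃ Y (n + 1) (extδ hT Y n e) = extδ hS Y n (extPre φ.τ₁ Y n e) := by
  simp only [extPre_apply, extδ_apply]
  rw [← Ext.comp_assoc (a₁₂ := 1) _ _ _ (by lia) (by lia) (by lia),
    ← ShortComplex.ShortExact.extClass_naturality hS hT φ, Ext.comp_assoc_of_second_deg_zero]

theorem extδ_eq_zero_iff {S : ShortComplex C} (hS : S.ShortExact) {Y : C} {n : ℕ}
    (e : Ext S.X₁ Y n) : extδ hS Y n e = 0 ↔ ∃ e', extPre S.f Y n e' = e := by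
  constructor
  · intro h
    exact Ext.contravariant_sequence_exact₁ hS Y e (add_comm 1 n) h
  · rintro ⟨e', rfl⟩
    exact hS.extClass_comp_assoc _ (h := add_comm 1 n)

theorem extPre_g_eq_zero_iff {S : ShortComplex C} (hS : S.ShortExact) {Y : C} {n : ℕ}
    (e : Ext S.X₃ Y (n + 1)) : extPre S.g Y (n + 1) e = 0 ↔ ∃ e', extδ hS Y n e' = e := by
  constructor
  · intro h
    exact Ext.contravariant_sequence_exact₃ hS Y e h (add_comm 1 n)
  · rintro ⟨e', rfl⟩
    exact hS.comp_extClass_assoc _ (add_comm 1 n)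

theorem extPre_f_eq_zero_iff {S : ShortComplex C} (hS : S.ShortExact) {Y : C} {n : ℕ}
    (e : Ext S.X₂ Y n) : extPre S.f Y n e = 0 ↔ ∃ e', extPre S.g Y n e' = e := by
  constructor
  · intro h
    exact Ext.contravariant_sequence_exact₂ hS Y e h
  · rintro ⟨e', rfl⟩
    rw [← extPre_comp, S.zero, extPre_zero]

theorem extδ_surjective {S : ShortComplex C} (hS : S.ShortExact) (Y : C) (n : ℕ)
    (h : Subsingleton (Ext S.X₂ Y (n + 1))) : Function.Surjective (extδ hS Y n) := fun e =>
  (extPre_g_eq_zero_iff hS e).1 (Subsingleton.elim _ _)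

theorem extδ_injective {S : ShortComplex C} (hS : S.ShortExact) (Y : C) (n : ℕ)
    (h : Subsingleton (Ext S.X₂ Y n)) : Function.Injective (extδ hS Y n) := by
  rw [injective_iff_map_eq_zero]
  intro e he
  obtain ⟨e', rfl⟩ := (extδ_eq_zero_iff hS e).1 he
  rw [Subsingleton.elim e' 0, map_zero]

theorem extPre_g_injective {S : ShortComplex C} (hS : S.ShortExact) (Y : C) :
    Function.Injective (extPre S.g Y 0) := by
  rw [injective_iff_map_eq_zero]
  intro e he
  obtain ⟨g, rfl⟩ := (Ext.mk₀_bijective _ _).2 e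
  rw [extPre_mk₀, Ext.mk₀_eq_zero_iff] at he
  have := hS.epi_g
  rw [Ext.mk₀_eq_zero_iff, ← cancel_epi S.g, he, Limits.comp_zero]

/-- Isomorphisms in both variables induce an isomorphism of `Ext` groups. -/
noncomputable def extCongr {X X' Y Y' : C} (f : X' ≅ X) (g : Y ≅ Y') (n : ℕ) :
    Ext X Y n ≃+ Ext X' Y' n where
  toFun e := extPre f.hom Y' n (extPost X g.hom n e)
  invFun e := extPre f.inv Y n (extPost X' g.inv n e)
  left_inv e := by
    dsimp only
    rw [← extPre_extPost, ← extPre_comp, ← extPost_comp]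
    simp
  right_inv e := by
    dsimp only
    rw [← extPre_extPost, ← extPre_comp, ← extPost_comp]
    simp
  map_add' := by simp

variable {D : Type u'} [Category.{v'} D] [Abelian D] [HasExt.{w'} D] (F : C ⥤ D) [F.Additive]
  [Limits.PreservesFiniteLimits F] [Limits.PreservesFiniteColimits F]

theorem mapExtAddHom_extPre {X X' Y : C} (f : X' ⟶ X) {n : ℕ} (e : Ext X Y n) :
    F.mapExtAddHom X' Y n (extPre f Y n e) =
      extPre (F.map f) (F.obj Y) n (F.mapExtAddHom X Y n e) := by
  simp only [extPre_apply, Functor.mapExtAddHom_apply, Ext.mapExactFunctor_comp,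
    Ext.mapExactFunctor_mk₀]

theorem mapExtAddHom_extδ {S : ShortComplex C} (hS : S.ShortExact) {Y : C} {n : ℕ}
    (e : Ext S.X₁ Y n) : F.mapExtAddHom S.X₃ Y (n + 1) (extδ hS Y n e) =
      extδ (hS.map_of_exact F) (F.obj Y) n (F.mapExtAddHom S.X₁ Y n e) := by
  simp only [extδ_apply, Functor.mapExtAddHom_apply, Ext.mapExactFunctor_comp]
  rw [Ext.mapExactFunctor_extClass]
  rfl

end ExtFunctoriality

section Summation

open Abelian

variable {R : Type} [Ring R]

theorem HasFiniteResolution.exists_shortExact {n : ℕ} {M : ModuleCat.{0} R}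
    (h : HasFiniteResolution R (n + 1) M) :
    ∃ (A P : ModuleCat.{0} R) (i : A ⟶ P) (p : P ⟶ M) (w : i ≫ p = 0),
      (ShortComplex.mk i p w).ShortExact ∧ HasFiniteResolution R n A ∧
      Module.Finite R P ∧ Projective P := by
  obtain ⟨P, _, _, f, h1, h2, h3, h4⟩ := h
  exact ⟨_, _, _, _, _, LinearMap.shortExact_shortComplexKer h3, h4, h1,
    (IsProjective.iff_projective _).1 h2⟩

theorem extPost_sum_eq_self {k : ℕ} {Y : ModuleCat.{0} R} {ι : Type} (t : ι → (Y ⟶ Y))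
    (ht : ∀ y : Y, ∃ s : Finset ι, ∀ s', s ⊆ s' → ∑ q ∈ s', (t q) y = y) {n : ℕ} :
    ∀ {M : ModuleCat.{0} R} (_ : HasFiniteResolution R k M) (e : Ext M Y n),
    ∃ s : Finset ι, ∀ s', s ⊆ s' → ∑ q ∈ s', extPost M (t q) n e = e := by
  classical
  induction n generalizing k with
  | zero =>
    intro M hM e
    obtain ⟨f, rfl⟩ := (Ext.mk₀_bijective _ _).2 e
    obtain ⟨S, hS⟩ := hM.finite.fg_top
    choose s hs using ht
    refine ⟨S.biUnion (fun m => s (f m)), fun s' hs' => ?_⟩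
    rw [← extPost_sum, extPost_mk₀]
    congr 1
    ext1
    refine LinearMap.ext_on hS fun m hm => ?_
    have := hs (f m) s' ((Finset.subset_biUnion_of_mem (fun m => s (f m)) hm).trans hs')
    rw [← this]
    simp [ModuleCat.hom_sum]
  | succ n ih =>
    intro M hM e
    obtain ⟨A, P, i, p, w, hS, hA, -, hP⟩ := hM.succ.exists_shortExact
    obtain ⟨e, rfl⟩ := extδ_surjective hS Y n (Ext.subsingleton_of_projective _ _ _) e
    obtain ⟨s, hs⟩ := ih hA e
    refine ⟨s, fun s' hs' => ?_⟩
    conv_rhs => rw [← hs s' hs']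
    rw [map_sum]
    refine Finset.sum_congr rfl fun q _ => ?_
    exact (extδ_extPost hS _ _).symm

theorem HasFiniteResolution.subsingleton_ext {k : ℕ} : ∀ {M : ModuleCat.{0} R}
    (_ : HasFiniteResolution R k M) (Y : ModuleCat.{0} R) (i : ℕ), k < i →
    Subsingleton (Ext M Y i) := by
  induction k with
  | zero =>
    intro M hM Y i hi
    obtain ⟨i, rfl⟩ := Nat.exists_eq_succ_of_ne_zero hi.ne'
    have : Projective M := (IsProjective.iff_projective _).1 hM.2
    exact Ext.subsingleton_of_projective _ _ _
  | succ k ih =>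
    intro M hM Y i hi
    obtain ⟨i, rfl⟩ := Nat.exists_eq_succ_of_ne_zero (Nat.zero_lt_of_lt hi).ne'
    obtain ⟨A, P, i', p, w, hS, hA, -, hP⟩ := hM.exists_shortExact
    have := ih hA Y i (by omega)
    exact (extδ_surjective hS Y i (Ext.subsingleton_of_projective _ _ _)).subsingleton

/-- Vanishing of `Ext` with coefficients in the ring above degree `n` implies vanishing with
arbitrary coefficients. -/
theorem subsingleton_ext_of_subsingleton_ext_self {k n : ℕ} {Z : ModuleCat.{0} R}
    (hZ : HasFiniteResolution R k Z)
    (h : ∀ i, n < i → Subsingleton (Ext Z (ModuleCat.of R R) i)) (M : ModuleCat.{0} R) (i : ℕ)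
    (hi : n < i) : Subsingleton (Ext Z M i) := by
  classical
  have key : ∀ j i, n < i → k < i + j → ∀ M : ModuleCat.{0} R, Subsingleton (Ext Z M i) := by
    intro j
    induction j with
    | zero => exact fun i _ hk M => hZ.subsingleton_ext M i hk
    | succ j ih =>
      intro i hi hk M
      have hsurj : Function.Surjective (Finsupp.linearCombination R (id : M → M)) := fun m =>
        ⟨Finsupp.single m 1, by simp⟩
      have hS := LinearMap.shortExact_shortComplexKer hsurj
      have h1 := ih (i + 1) (by omega) (by omega)
        (ModuleCat.of R (LinearMap.ker (Finsupp.linearCombination R (id : M → M))))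
      have h2 : Subsingleton (Ext Z (ModuleCat.of R (M →₀ R)) i) := by
        refine subsingleton_of_forall_eq 0 fun e => ?_
        let t : M → (ModuleCat.of R (M →₀ R) ⟶ ModuleCat.of R (M →₀ R)) := fun q =>
          ModuleCat.ofHom (Finsupp.lapply q) ≫ ModuleCat.ofHom (Finsupp.lsingle q)
        obtain ⟨s, hs⟩ := extPost_sum_eq_self t (fun y => ⟨y.support, fun s' hs' => by
          have : ∑ q ∈ s', Finsupp.single q (y q) = y := by
            conv_rhs => rw [← Finsupp.sum_single y]
            exact (Finsupp.sum_of_support_subset y hs' _ (by simp)).symm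
          exact this⟩) hZ e
        rw [← hs s subset_rfl]
        refine Finset.sum_eq_zero fun q _ => ?_
        have := h i hi
        rw [extPost_comp, Subsingleton.elim (extPost Z (ModuleCat.ofHom (Finsupp.lapply q)) i e) 0,
          map_zero]
      refine subsingleton_of_forall_eq 0 fun e => ?_
      obtain ⟨e', rfl⟩ := Ext.covariant_sequence_exact₃ Z hS e rfl
        (h1.elim _ _)
      have : e' = 0 := Subsingleton.elim (α := Ext Z (ModuleCat.of R (M →₀ R)) i) _ _
      rw [this, Ext.zero_comp]
  exact key (k + 1) i hi (by omega) M

end Summation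

section Devissage

open Abelian

variable {R S : Type} [Ring R] [Ring S] (φ : R →+* S)

theorem shortExact_map_restrictScalars {S' : ShortComplex (ModuleCat.{0} S)}
    (hS : S'.ShortExact) : (S'.map (ModuleCat.restrictScalars φ)).ShortExact :=
  ModuleCat.shortComplex_shortExact _
    ((ShortComplex.ShortExact.moduleCat_exact_iff_function_exact S').1 hS.exact)
    hS.moduleCat_injective_f hS.moduleCat_surjective_g

theorem preservesFiniteLimits_and_colimits_restrictScalars :
    Limits.PreservesFiniteLimits (ModuleCat.restrictScalars.{0} φ) ∧
      Limits.PreservesFiniteColimits (ModuleCat.restrictScalars.{0} φ) :=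
  ((Functor.exact_tfae (ModuleCat.restrictScalars.{0} φ)).out 0 3).1
    fun _ => shortExact_map_restrictScalars φ

instance : Limits.PreservesFiniteLimits (ModuleCat.restrictScalars.{0} φ) :=
  (preservesFiniteLimits_and_colimits_restrictScalars φ).1

instance : Limits.PreservesFiniteColimits (ModuleCat.restrictScalars.{0} φ) :=
  (preservesFiniteLimits_and_colimits_restrictScalars φ).2

theorem toSpanSingleton_one_eq_id : LinearMap.toSpanSingleton S S 1 = LinearMap.id := by
  ext
  simp

/-- The `Ext` group of the restriction of scalars of `S` is an `S`-module through the right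
multiplications of `S`. -/
noncomputable instance extSelfModule (X : ModuleCat.{0} R) (n : ℕ) :
    Module S (Ext ((ModuleCat.restrictScalars φ).obj (ModuleCat.of S S)) X n) where
  smul a e := extPre ((ModuleCat.restrictScalars φ).map
    (ModuleCat.ofHom (LinearMap.toSpanSingleton S S a))) X n e
  one_smul e := by
    change extPre _ X n e = e
    rw [toSpanSingleton_one_eq_id, ModuleCat.ofHom_id, CategoryTheory.Functor.map_id, extPre_id]
  mul_smul a b e := by
    change extPre _ X n e = extPre _ X n (extPre _ X n e)
    rw [← extPre_comp, ← Functor.map_comp, ← ModuleCat.ofHom_comp]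
    congr 4
    ext
    simp
  smul_zero a := map_zero _
  smul_add a := map_add _
  add_smul a b e := by
    change extPre _ X n e = extPre _ X n e + extPre _ X n e
    rw [LinearMap.toSpanSingleton_add, ModuleCat.ofHom_add, Functor.map_add, extPre_add]
  zero_smul e := by
    change extPre _ X n e = 0
    rw [LinearMap.toSpanSingleton_zero, ModuleCat.ofHom_zero, Functor.map_zero, extPre_zero]

/-- `Ext` of the restriction of scalars of `S`, as an `S`-module. -/
noncomputable abbrev extSelf (X : ModuleCat.{0} R) (n : ℕ) : ModuleCat.{0} S :=
  ModuleCat.of S (Ext ((ModuleCat.restrictScalars φ).obj (ModuleCat.of S S)) X n)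

/-- Evaluating an `Ext` class on the elements of a module. -/
noncomputable def extEval (X : ModuleCat.{0} R) (n : ℕ) (M : ModuleCat.{0} S) :
    Ext ((ModuleCat.restrictScalars φ).obj M) X n →+ (M ⟶ extSelf φ X n) :=
  AddMonoidHom.mk' (fun e => ModuleCat.ofHom
    { toFun := fun m => extPre ((ModuleCat.restrictScalars φ).map
        (ModuleCat.ofHom (LinearMap.toSpanSingleton S M m))) X n e
      map_add' := fun m m' => by
        rw [LinearMap.toSpanSingleton_add, ModuleCat.ofHom_add, Functor.map_add, extPre_add]
      map_smul' := fun a m => by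
        change extPre _ X n e = extPre _ X n (extPre _ X n e)
        rw [← extPre_comp, ← Functor.map_comp, ← ModuleCat.ofHom_comp]
        congr 4
        ext
        simp }) (fun e e' => by
    ext m
    exact map_add (extPre ((ModuleCat.restrictScalars φ).map
        (ModuleCat.ofHom (LinearMap.toSpanSingleton S M m))) X n) e e')

theorem extEval_apply (X : ModuleCat.{0} R) (n : ℕ) (M : ModuleCat.{0} S)
    (e : Ext ((ModuleCat.restrictScalars φ).obj M) X n) (m : M) :
    extEval φ X n M e m = extPre ((ModuleCat.restrictScalars φ).map
        (ModuleCat.ofHom (LinearMap.toSpanSingleton S M m))) X n e := rfl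

theorem extEval_naturality (X : ModuleCat.{0} R) (n : ℕ) {M N : ModuleCat.{0} S} (f : M ⟶ N)
    (e : Ext ((ModuleCat.restrictScalars φ).obj N) X n) :
    extEval φ X n M (extPre ((ModuleCat.restrictScalars φ).map f) X n e) =
      f ≫ extEval φ X n N e := by
  refine ModuleCat.hom_ext (LinearMap.ext fun m => ?_)
  change _ = extEval φ X n N e (f m)
  rw [extEval_apply, extEval_apply, ← extPre_comp, ← Functor.map_comp]
  congr 3
  ext
  simp

/-- The dual basis lemma for finitely generated projective modules. -/
theorem exists_finite_dual_basis (M : ModuleCat.{0} S) (hM : HasFiniteResolution S 0 M) :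
    ∃ (k : ℕ) (f : Fin k → (M ⟶ ModuleCat.of S S)) (m : Fin k → M),
      𝟙 M = ∑ i, f i ≫ ModuleCat.ofHom (LinearMap.toSpanSingleton S M (m i)) := by
  obtain ⟨h1, h2⟩ := hM
  obtain ⟨k, p, hp⟩ := Module.Finite.exists_fin' S M
  obtain ⟨s, hs⟩ := Module.projective_lifting_property p LinearMap.id hp
  refine ⟨k, fun i => ModuleCat.ofHom (LinearMap.proj i ∘ₗ s), fun i => p (Pi.single i 1), ?_⟩
  ext x
  have hx : p (s x) = x := LinearMap.congr_fun hs x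
  simp only [ModuleCat.id_apply, ModuleCat.hom_sum, ModuleCat.hom_comp, LinearMap.coe_sum,
    Finset.sum_apply]
  conv_lhs => rw [← hx, pi_eq_sum_univ (s x), map_sum]
  refine Finset.sum_congr rfl fun i _ => ?_
  rw [map_smul]
  change _ = s x i • p (Pi.single i 1)
  congr 2
  ext j
  simp [Pi.single_apply, eq_comm]

theorem subsingleton_ext_of_finite_projective (X : ModuleCat.{0} R) (i : ℕ)
    (h : Subsingleton (Ext ((ModuleCat.restrictScalars φ).obj (ModuleCat.of S S)) X i))
    {M : ModuleCat.{0} S} (hM : HasFiniteResolution S 0 M) :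
    Subsingleton (Ext ((ModuleCat.restrictScalars φ).obj M) X i) := by
  obtain ⟨k, f, m, hfm⟩ := exists_finite_dual_basis M hM
  refine subsingleton_of_forall_eq 0 fun e => ?_
  rw [← extPre_id e, ← CategoryTheory.Functor.map_id, hfm, Functor.map_sum, extPre_sum]
  refine Finset.sum_eq_zero fun j _ => ?_
  rw [Functor.map_comp, extPre_comp,
    Subsingleton.elim (extPre ((ModuleCat.restrictScalars φ).map
      (ModuleCat.ofHom (LinearMap.toSpanSingleton S M (m j)))) X i e) 0, map_zero]

theorem extEval_bijective_of_finite_projective (X : ModuleCat.{0} R) (n : ℕ)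
    {M : ModuleCat.{0} S} (hM : HasFiniteResolution S 0 M) :
    Function.Bijective (extEval φ X n M) := by
  obtain ⟨k, f, m, hfm⟩ := exists_finite_dual_basis M hM
  have key : ∀ e, e = ∑ j, extPre ((ModuleCat.restrictScalars φ).map (f j)) X n
      (extEval φ X n M e (m j)) := fun e => by
    conv_lhs => rw [← extPre_id e, ← CategoryTheory.Functor.map_id, hfm,
      Functor.map_sum, extPre_sum]
    refine Finset.sum_congr rfl fun j _ => ?_
    rw [Functor.map_comp, extPre_comp, extEval_apply]
  constructor
  · rw [injective_iff_map_eq_zero]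
    intro e he
    rw [key e, he]
    exact Finset.sum_eq_zero fun j _ => map_zero _
  · intro h
    refine ⟨∑ j, extPre ((ModuleCat.restrictScalars φ).map (f j)) X n (h (m j)), ?_⟩
    rw [map_sum]
    have h2 : ∀ t, extEval φ X n (ModuleCat.of S S) t =
        ModuleCat.ofHom (LinearMap.toSpanSingleton S (extSelf φ X n) t) := fun t => by
      ext
      change extEval φ X n (ModuleCat.of S S) t (1 : S) = (1 : S) • t
      rw [one_smul, extEval_apply, toSpanSingleton_one_eq_id, ModuleCat.ofHom_id,
        CategoryTheory.Functor.map_id, extPre_id]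
    conv_rhs => rw [← Category.id_comp h, hfm, Preadditive.sum_comp]
    refine Finset.sum_congr rfl fun j _ => ?_
    rw [extEval_naturality, h2, Category.assoc]
    congr 1
    ext
    simp

variable (X : ModuleCat.{0} R) (n : ℕ)

theorem subsingleton_ext_of_lt
    (hX : ∀ i ≠ n, Subsingleton (Ext ((ModuleCat.restrictScalars φ).obj (ModuleCat.of S S)) X i))
    {k : ℕ} : ∀ {M : ModuleCat.{0} S}
    (_ : HasFiniteResolution S k M) (i : ℕ), i < n →
    Subsingleton (Ext ((ModuleCat.restrictScalars φ).obj M) X i) := by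
  induction k with
  | zero => exact fun hM i hi => subsingleton_ext_of_finite_projective φ X i (hX i hi.ne) hM
  | succ k ih =>
    intro M hM i hi
    obtain ⟨A, P, a, p, w, hS, hA, hP1, hP2⟩ := hM.exists_shortExact
    have hP : HasFiniteResolution S 0 P := ⟨hP1, (IsProjective.iff_projective _).2 hP2⟩
    have hS' := hS.map_of_exact (ModuleCat.restrictScalars φ)
    have hP' := subsingleton_ext_of_finite_projective φ X i (hX i hi.ne) hP
    cases i with
    | zero => exact @Function.Injective.subsingleton _ _ _ (extPre_g_injective hS' X) hP'
    | succ i =>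
      have := ih hA i (by omega)
      exact @Function.Surjective.subsingleton _ _ _ this (extδ_surjective hS' X i hP')

theorem extEval_bijective
    (hX : ∀ i ≠ n, Subsingleton (Ext ((ModuleCat.restrictScalars φ).obj (ModuleCat.of S S)) X i))
    {k : ℕ} : ∀ {M : ModuleCat.{0} S}
    (_ : HasFiniteResolution S k M), Function.Bijective (extEval φ X n M) := by
  induction k with
  | zero => exact fun hM => extEval_bijective_of_finite_projective φ X n hM
  | succ k ih =>
    intro M hM
    obtain ⟨A, P, a, p, w, hS, hA, hP1, hP2⟩ := hM.exists_shortExact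
    have hP : HasFiniteResolution S 0 P := ⟨hP1, (IsProjective.iff_projective _).2 hP2⟩
    have hS' := hS.map_of_exact (ModuleCat.restrictScalars φ)
    have hp : Epi p := hS.epi_g
    constructor
    · have h1 : Function.Injective (extPre ((ModuleCat.restrictScalars φ).map p) X n) := by
        cases n with
        | zero => exact extPre_g_injective hS' X
        | succ n =>
          rw [injective_iff_map_eq_zero]
          intro e he
          obtain ⟨e', rfl⟩ := (extPre_g_eq_zero_iff hS' e).1 he
          have : e' = 0 := (subsingleton_ext_of_lt φ X _ hX hA n (by omega)).elim _ _
          rw [this]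
          exact map_zero _
      rw [injective_iff_map_eq_zero]
      intro e he
      apply h1
      apply (extEval_bijective_of_finite_projective φ X n hP).1
      rw [extEval_naturality, he, map_zero, map_zero, Limits.comp_zero]
    · intro h
      obtain ⟨e1, he1⟩ := (extEval_bijective_of_finite_projective φ X n hP).2 (p ≫ h)
      have h2 : extPre ((ModuleCat.restrictScalars φ).map a) X n e1 = 0 := by
        apply (ih hA).1
        rw [extEval_naturality, he1, map_zero, ← Category.assoc, w, Limits.zero_comp]
      obtain ⟨e, he⟩ := (extPre_f_eq_zero_iff hS' e1).1 h2
      refine ⟨e, ?_⟩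
      rw [← cancel_epi p]
      refine (extEval_naturality φ X n p e).symm.trans (Eq.trans ?_ he1)
      exact congrArg _ he

/-- If `Ext` of the restriction of `S` is concentrated in degree `n`, then `Ext` over `R` of a
module over `S` is, up to a shift by `n`, an `Ext` group over `S`. -/
theorem nonempty_ext_addEquiv_ext_extSelf
    (hX : ∀ i ≠ n, Subsingleton (Ext ((ModuleCat.restrictScalars φ).obj (ModuleCat.of S S)) X i))
    {k : ℕ} : ∀ {M : ModuleCat.{0} S}
    (_ : HasFiniteResolution S k M) (j : ℕ),
    Nonempty (Ext ((ModuleCat.restrictScalars φ).obj M) X (n + j) ≃+ Ext M (extSelf φ X n) j) := by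
  have h0 : ∀ {k : ℕ} {M : ModuleCat.{0} S} (_ : HasFiniteResolution S k M),
      Nonempty (Ext ((ModuleCat.restrictScalars φ).obj M) X n ≃+ Ext M (extSelf φ X n) 0) :=
    fun hM => ⟨(AddEquiv.ofBijective _ (extEval_bijective φ X n hX hM)).trans
      Ext.addEquiv₀.symm⟩
  induction k with
  | zero =>
    intro M hM j
    cases j with
    | zero => exact h0 hM
    | succ j =>
      have := subsingleton_ext_of_finite_projective φ X (n + (j + 1)) (hX _ (by omega)) hM
      have hM' : Projective M := (IsProjective.iff_projective _).1 hM.2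
      have h2 := Ext.subsingleton_of_projective M (extSelf φ X n) j
      exact ⟨⟨⟨fun _ => 0, fun _ => 0, fun _ => Subsingleton.elim _ _,
        fun _ => Subsingleton.elim _ _⟩, fun _ _ => (add_zero _).symm⟩⟩
  | succ k ih =>
    intro M hM j
    obtain ⟨A, P, a, p, w, hS, hA, hP1, hP2⟩ := hM.exists_shortExact
    have hP : HasFiniteResolution S 0 P := ⟨hP1, (IsProjective.iff_projective _).2 hP2⟩
    have hS' := hS.map_of_exact (ModuleCat.restrictScalars φ)
    have hP' : ∀ i ≠ n, Subsingleton (Ext ((ModuleCat.restrictScalars φ).obj P) X i) :=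
      fun i hi => subsingleton_ext_of_finite_projective φ X i (hX i hi) hP
    match j with
    | 0 => exact h0 hM
    | 1 =>
      let eA := AddEquiv.ofBijective _ (extEval_bijective φ X n hX hA)
      let eP := AddEquiv.ofBijective _ (extEval_bijective φ X n hX hP)
      refine nonempty_addEquiv_of_surjective (extδ hS' X n)
        ((extδ hS (extSelf φ X n) 0).comp
          (Ext.addEquiv₀.symm.toAddMonoidHom.comp eA.toAddMonoidHom))
        (extδ_surjective hS' X n (hP' _ (by omega))) ?_ ?_
      · exact (extδ_surjective hS (extSelf φ X n) 0 (Ext.subsingleton_of_projective _ _ _)).comp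
          (Ext.addEquiv₀.symm.surjective.comp eA.surjective)
      · intro e
        refine (extδ_eq_zero_iff hS' e).trans (Iff.trans ?_ (extδ_eq_zero_iff hS _).symm)
        constructor
        · rintro ⟨e', rfl⟩
          refine ⟨Ext.mk₀ (eP e'), ?_⟩
          refine (extPre_mk₀ _ _).trans (congrArg Ext.mk₀ ?_)
          exact (extEval_naturality φ X n a e').symm
        · rintro ⟨e', he'⟩
          obtain ⟨h, rfl⟩ := (Ext.mk₀_bijective _ _).2 e'
          obtain ⟨e', rfl⟩ := eP.surjective h
          refine ⟨e', eA.injective ?_⟩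
          refine (extEval_naturality φ X n a e').trans ?_
          exact (Ext.mk₀_bijective _ _).1 ((extPre_mk₀ _ _).symm.trans he')
    | j + 2 =>
      obtain ⟨e⟩ := ih hA (j + 1)
      exact ⟨(AddEquiv.ofBijective _ ⟨extδ_injective hS' X (n + (j + 1)) (hP' _ (by omega)),
        extδ_surjective hS' X (n + (j + 1)) (hP' _ (by omega))⟩).symm.trans (e.trans
        (AddEquiv.ofBijective _ ⟨extδ_injective hS (extSelf φ X n) (j + 1)
          (Ext.subsingleton_of_projective _ _ _),
        extδ_surjective hS (extSelf φ X n) (j + 1) (Ext.subsingleton_of_projective _ _ _)⟩))⟩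

end Devissage

section GroupRing

variable {G : Type} [Group G]

theorem single_one_smul {M : Type} [AddCommGroup M] [Module (MonoidAlgebra ℤ G) M] (m : M) :
    MonoidAlgebra.single (1 : G) (1 : ℤ) • m = m := by
  rw [← MonoidAlgebra.one_def, one_smul]

theorem single_mul_smul {M : Type} [AddCommGroup M] [Module (MonoidAlgebra ℤ G) M] (g h : G)
    (m : M) : MonoidAlgebra.single (g * h) (1 : ℤ) • m =
      MonoidAlgebra.single g (1 : ℤ) • MonoidAlgebra.single h (1 : ℤ) • m := by
  rw [← mul_smul, MonoidAlgebra.single_mul_single, one_mul]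

/-- An additive map commuting with the action of a group is linear over the group ring. -/
def groupRingLinearMap {M N : Type} [AddCommGroup M] [Module (MonoidAlgebra ℤ G) M]
    [AddCommGroup N] [Module (MonoidAlgebra ℤ G) N] (f : M →+ N)
    (hf : ∀ (g : G) m, f (MonoidAlgebra.single g (1 : ℤ) • m) =
      MonoidAlgebra.single g (1 : ℤ) • f m) : M →ₗ[MonoidAlgebra ℤ G] N where
  toFun := f
  map_add' := map_add f
  map_smul' a m := by
    induction a using MonoidAlgebra.induction_linear with
    | zero => simp
    | add x y hx hy => simp_all [add_smul]
    | single g r =>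
      have : MonoidAlgebra.single g r = r • MonoidAlgebra.single g (1 : ℤ) := by
        simp [MonoidAlgebra.smul_single]
      rw [RingHom.id_apply, this, smul_assoc, smul_assoc, map_zsmul, hf]

/-- Restriction of group ring modules along a group homomorphism. -/
noncomputable abbrev resFunctor {K : Type} [Group K] (ι : K →* G) :
    ModuleCat.{0} (MonoidAlgebra ℤ G) ⥤ ModuleCat.{0} (MonoidAlgebra ℤ K) :=
  ModuleCat.restrictScalars (MonoidAlgebra.mapDomainRingHom ℤ ι)

theorem resFunctor_single_smul {K : Type} [Group K] (ι : K →* G)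
    (M : ModuleCat.{0} (MonoidAlgebra ℤ G)) (k : K) (m : (resFunctor ι).obj M) :
    MonoidAlgebra.single k (1 : ℤ) • m =
      (MonoidAlgebra.single (ι k) (1 : ℤ) • (show M from m) : M) := by
  rw [ModuleCat.restrictScalars.smul_def, MonoidAlgebra.mapDomainRingHom_apply,
    MonoidAlgebra.mapDomain_single]

end GroupRing

theorem finsuppMapRange_exact {ι A L M N : Type} [Ring A] [AddCommGroup L] [AddCommGroup M]
    [AddCommGroup N] [Module A L] [Module A M] [Module A N] (f : L →ₗ[A] M) (g : M →ₗ[A] N)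
    (h : Function.Exact f g) :
    Function.Exact (Finsupp.mapRange (α := ι) f (map_zero f))
      (Finsupp.mapRange (α := ι) g (map_zero g)) := by
  classical
  intro y
  constructor
  · intro hy
    have hy' : ∀ q, ∃ x, f x = y q := fun q => (h _).1 (DFunLike.congr_fun hy q)
    choose x hx using hy'
    refine ⟨Finsupp.onFinset y.support (fun q => if y q = 0 then 0 else x q) ?_, ?_⟩
    · intro q hq
      rw [Finsupp.mem_support_iff]
      intro h0
      exact hq (if_pos h0)
    · ext q
      rw [Finsupp.mapRange_apply, Finsupp.onFinset_apply]
      split_ifs with h0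
      · rw [map_zero, h0]
      · exact hx q
  · rintro ⟨x, rfl⟩
    ext q
    rw [Finsupp.mapRange_apply, Finsupp.mapRange_apply]
    exact (h _).2 ⟨_, rfl⟩

/-- A cocycle for the action of `G` on `Q` by left translations, with values in a ring. -/
structure TranslationCocycle {G Q : Type} [Group G] [Group Q] (π : G →* Q) (A : Type) [Ring A] where
  /-- the underlying function -/
  toFun : G → Q → A
  map_one : ∀ q, toFun 1 q = 1
  map_mul : ∀ g h q, toFun (g * h) q = toFun g (π h * q) * toFun h q

namespace TranslationCocycle

open Abelian

variable {G Q : Type} [Group G] [Group Q] {π : G →* Q} {A : Type} [Ring A]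
  (c : TranslationCocycle π A)

/-- The carrier of the module induced through a cocycle. -/
def Carrier (_ : TranslationCocycle π A) (M : Type) [AddCommGroup M] : Type := Q →₀ M

noncomputable instance (M : Type) [AddCommGroup M] : AddCommGroup (c.Carrier M) :=
  inferInstanceAs (AddCommGroup (Q →₀ M))

/-- The elements of the induced module supported at one point. -/
noncomputable def single {M : Type} [AddCommGroup M] (q : Q) : M →+ c.Carrier M :=
  Finsupp.singleAddHom q

/-- Additive maps out of the induced module. -/
noncomputable def lift {M N : Type} [AddCommGroup M] [AddCommGroup N] (f : Q → M →+ N) :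
    c.Carrier M →+ N :=
  Finsupp.liftAddHom f

@[simp]
theorem lift_single {M N : Type} [AddCommGroup M] [AddCommGroup N] (f : Q → M →+ N) (q : Q)
    (m : M) : c.lift f (c.single q m) = f q m :=
  Finsupp.liftAddHom_apply_single _ _ _

theorem hom_ext {M N : Type} [AddCommGroup M] [AddCommGroup N] {f g : c.Carrier M →+ N}
    (h : ∀ q m, f (c.single q m) = g (c.single q m)) : f = g :=
  Finsupp.addHom_ext h

theorem hom_congr {M N : Type} [AddCommGroup M] [AddCommGroup N] (f g : c.Carrier M →+ N)
    (h : ∀ q m, f (c.single q m) = g (c.single q m)) (x : c.Carrier M) : f x = g x :=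
  DFunLike.congr_fun (c.hom_ext h) x

variable {M : Type} [AddCommGroup M] [Module A M]

/-- The action of an element of `G` on the induced module. -/
noncomputable def actionHom (g : G) : c.Carrier M →+ c.Carrier M :=
  c.lift fun q => (c.single (π g * q)).comp (DistribSMul.toAddMonoidHom M (c.toFun g q))

theorem actionHom_single (g : G) (q : Q) (m : M) :
    c.actionHom g (c.single q m) = c.single (π g * q) (c.toFun g q • m) :=
  c.lift_single _ _ _

/-- The action of `G` on the induced module. -/
noncomputable def action : G →* Module.End ℤ (c.Carrier M) where
  toFun g := (c.actionHom g).toIntLinearMap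
  map_one' := LinearMap.ext fun x => c.hom_congr (c.actionHom 1) (AddMonoidHom.id _)
    (fun q m => by simp [c.map_one, actionHom_single]) x
  map_mul' g h := LinearMap.ext fun x => c.hom_congr (c.actionHom (g * h))
    ((c.actionHom g).comp (c.actionHom h))
    (fun q m => by simp [c.map_mul, actionHom_single, mul_smul, mul_assoc]) x

noncomputable instance : Module (MonoidAlgebra ℤ G) (c.Carrier M) :=
  Module.compHom _ (MonoidAlgebra.lift ℤ (Module.End ℤ (c.Carrier M)) G c.action).toRingHom

theorem single_smul_single (g : G) (q : Q) (m : M) :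
    MonoidAlgebra.single g (1 : ℤ) • c.single q m = c.single (π g * q) (c.toFun g q • m) := by
  change MonoidAlgebra.lift ℤ (Module.End ℤ (c.Carrier M)) G c.action
    (MonoidAlgebra.single g 1) (c.single q m) = _
  rw [MonoidAlgebra.lift_single, one_smul]
  exact c.actionHom_single _ _ _

theorem single_eq_smul_single_one (g : G) (m : M) :
    c.single (π g) m =
      MonoidAlgebra.single g (1 : ℤ) • c.single 1 (c.toFun g⁻¹ (π g) • m) := by
  rw [single_smul_single, mul_one, ← mul_smul]
  have := c.map_mul g g⁻¹ (π g)
  rw [mul_inv_cancel, c.map_one, map_inv, inv_mul_cancel] at this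
  rw [← this, one_smul]

/-- Functoriality of the induced module. -/
noncomputable def mapHom {N : Type} [AddCommGroup N] [Module A N] (f : M →ₗ[A] N) :
    c.Carrier M →ₗ[MonoidAlgebra ℤ G] c.Carrier N :=
  groupRingLinearMap (c.lift fun q => (c.single q).comp f.toAddMonoidHom) fun g x =>
    c.hom_congr ((c.lift fun q => (c.single q).comp f.toAddMonoidHom).comp
      (DistribSMul.toAddMonoidHom _ (MonoidAlgebra.single g (1 : ℤ))))
      ((DistribSMul.toAddMonoidHom _ (MonoidAlgebra.single g (1 : ℤ))).comp
      (c.lift fun q => (c.single q).comp f.toAddMonoidHom))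
      (fun q m => by simp [single_smul_single]) x

theorem mapHom_single {N : Type} [AddCommGroup N] [Module A N] (f : M →ₗ[A] N) (q : Q) (m : M) :
    c.mapHom f (c.single q m) = c.single q (f m) :=
  c.lift_single _ _ _

theorem linearMap_ext {N : Type} [AddCommGroup N] [Module (MonoidAlgebra ℤ G) N]
    {f g : c.Carrier M →ₗ[MonoidAlgebra ℤ G] N}
    (h : ∀ q m, f (c.single q m) = g (c.single q m)) : f = g :=
  LinearMap.ext (c.hom_congr f.toAddMonoidHom g.toAddMonoidHom h)

theorem mapHom_apply {N : Type} [AddCommGroup N] [Module A N] (f : M →ₗ[A] N) (x : c.Carrier M) :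
    c.mapHom f x = Finsupp.mapRange f (map_zero f) x :=
  c.hom_congr (c.mapHom f).toAddMonoidHom (Finsupp.mapRange.addMonoidHom f.toAddMonoidHom)
    (fun q m => (c.mapHom_single f q m).trans
      (Finsupp.mapRange_single (hf := map_zero f)).symm) x

/-- The functor sending a module to the module induced through a cocycle. -/
noncomputable def functor : ModuleCat.{0} A ⥤ ModuleCat.{0} (MonoidAlgebra ℤ G) where
  obj M := ModuleCat.of _ (c.Carrier M)
  map f := ModuleCat.ofHom (c.mapHom f.hom)
  map_id M := ModuleCat.hom_ext (c.linearMap_ext fun q m => c.mapHom_single _ _ _)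
  map_comp f g := ModuleCat.hom_ext (c.linearMap_ext fun q m => by
    refine (c.mapHom_single _ _ _).trans ?_
    exact ((congrArg (c.mapHom g.hom) (c.mapHom_single f.hom q m)).trans
      (c.mapHom_single _ _ _)).symm)

instance : c.functor.Additive where
  map_add {M N f g} := ModuleCat.hom_ext (c.linearMap_ext fun q m => by
    refine (c.mapHom_single _ _ _).trans ((map_add (c.single q) _ _).trans ?_)
    exact (congrArg₂ (· + ·) (c.mapHom_single f.hom q m) (c.mapHom_single g.hom q m)).symm)

theorem shortExact_map {S : ShortComplex (ModuleCat.{0} A)} (hS : S.ShortExact) :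
    (S.map c.functor).ShortExact := by
  refine ModuleCat.shortComplex_shortExact _ ?_ ?_ ?_
  · have h := (ShortComplex.ShortExact.moduleCat_exact_iff_function_exact S).1 hS.exact
    intro y
    refine (Eq.congr_left (c.mapHom_apply S.g.hom y)).trans
      ((finsuppMapRange_exact S.f.hom S.g.hom h y).trans ?_)
    exact exists_congr fun x => (Eq.congr_left (c.mapHom_apply S.f.hom x)).symm
  · intro x y hxy
    refine Finsupp.mapRange_injective _ (map_zero S.f.hom) hS.moduleCat_injective_f ?_
    exact (c.mapHom_apply S.f.hom x).symm.trans (hxy.trans (c.mapHom_apply S.f.hom y))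
  · intro y
    obtain ⟨x, hx⟩ := Finsupp.mapRange_surjective S.g.hom (map_zero S.g.hom)
      hS.moduleCat_surjective_g y
    exact ⟨x, (c.mapHom_apply S.g.hom x).trans hx⟩

end TranslationCocycle

namespace TranslationCocycle

open Abelian

variable {K G Q : Type} [Group K] [Group G] [Group Q] {ι : K →* G} {π : G →* Q} {A : Type} [Ring A]
  (c : TranslationCocycle π A) (ψ : MonoidAlgebra ℤ K →+* A)
  (hπι : ∀ k, π (ι k) = 1)
  (hψ : ∀ k, c.toFun (ι k) 1 = ψ (MonoidAlgebra.single k 1))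

/-- The inclusion of a module in the induced module. -/
noncomputable def unit (M : ModuleCat.{0} A) :
    (ModuleCat.restrictScalars ψ).obj M ⟶ (resFunctor ι).obj (c.functor.obj M) :=
  ModuleCat.ofHom (X := (ModuleCat.restrictScalars ψ).obj M)
    (Y := (resFunctor ι).obj (c.functor.obj M))
    (groupRingLinearMap (M := (ModuleCat.restrictScalars ψ).obj M)
      (N := (resFunctor ι).obj (c.functor.obj M)) (c.single 1) fun k m => by
      refine Eq.trans ?_ (resFunctor_single_smul ι (c.functor.obj M) k _).symm
      refine Eq.trans ?_ (c.single_smul_single (ι k) 1 m).symm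
      rw [hπι, one_mul, hψ]
      rfl)

theorem unit_naturality {M N : ModuleCat.{0} A} (f : M ⟶ N) :
    (ModuleCat.restrictScalars ψ).map f ≫ c.unit ψ hπι hψ N =
      c.unit ψ hπι hψ M ≫ (resFunctor ι).map (c.functor.map f) :=
  ModuleCat.hom_ext (LinearMap.ext fun m => (c.mapHom_single f.hom 1 m).symm)

theorem unit_comp_injective (M : ModuleCat.{0} A) (Y : ModuleCat.{0} (MonoidAlgebra ℤ G))
    (hπ : Function.Surjective π) :
    Function.Injective fun f : c.functor.obj M ⟶ Y =>
      c.unit ψ hπι hψ M ≫ (resFunctor ι).map f := by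
  intro f f' h
  have h1 : ∀ m : M, f (c.single 1 m) = f' (c.single 1 m) := fun m =>
    LinearMap.congr_fun (congrArg ModuleCat.Hom.hom h) m
  refine ModuleCat.hom_ext (c.linearMap_ext fun q m => ?_)
  obtain ⟨g, rfl⟩ := hπ q
  rw [single_eq_smul_single_one]
  refine (map_smul f.hom _ _).trans (Eq.trans ?_ (map_smul f'.hom _ _).symm)
  exact congrArg _ (h1 _)

theorem unit_comp_surjective (M : ModuleCat.{0} A) (Y : ModuleCat.{0} (MonoidAlgebra ℤ G))
    (hπ : Function.Surjective π) (hexact : ι.range = π.ker) :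
    Function.Surjective fun f : c.functor.obj M ⟶ Y =>
      c.unit ψ hπι hψ M ≫ (resFunctor ι).map f := by
  intro h
  choose s hs using hπ
  let h' : M →+ Y := h.hom.toAddMonoidHom
  have hh' : ∀ k m, h' (c.toFun (ι k) 1 • m) = MonoidAlgebra.single (ι k) (1 : ℤ) • h' m := by
    intro k m
    rw [hψ]
    exact (map_smul h.hom (MonoidAlgebra.single k (1 : ℤ))
      (show (ModuleCat.restrictScalars ψ).obj M from m)).trans
      (resFunctor_single_smul ι Y k _)
  let F : c.Carrier M →+ Y := c.lift fun q =>
    (DistribSMul.toAddMonoidHom Y (MonoidAlgebra.single (s q) (1 : ℤ))).comp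
      (h'.comp (DistribSMul.toAddMonoidHom M (c.toFun (s q)⁻¹ q)))
  have hF : ∀ q m, F (c.single q m) =
      MonoidAlgebra.single (s q) (1 : ℤ) • h' (c.toFun (s q)⁻¹ q • m) := fun q m =>
    c.lift_single _ _ _
  have hF' : ∀ (g : G) x, F (MonoidAlgebra.single g (1 : ℤ) • x) =
      MonoidAlgebra.single g (1 : ℤ) • F x := fun g x =>
    c.hom_congr (F.comp (DistribSMul.toAddMonoidHom _ (MonoidAlgebra.single g (1 : ℤ))))
      ((DistribSMul.toAddMonoidHom _ (MonoidAlgebra.single g (1 : ℤ))).comp F)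
      (fun q m => by
        have hk : (s (π g * q))⁻¹ * g * s q ∈ ι.range := by
          rw [hexact, MonoidHom.mem_ker]
          simp [hs, mul_assoc]
        obtain ⟨k, hk⟩ := hk
        have hk2 : (s (π g * q))⁻¹ * g = ι k * (s q)⁻¹ := by rw [hk]; group
        have hk3 : s (π g * q) * ι k = g * s q := by rw [hk]; group
        simp only [AddMonoidHom.comp_apply, DistribSMul.toAddMonoidHom_apply]
        rw [single_smul_single, hF, hF, ← mul_smul, ← c.map_mul, hk2, c.map_mul, map_inv, hs,
          inv_mul_cancel, mul_smul, hh', ← single_mul_smul, ← single_mul_smul, hk3]) x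
  refine ⟨ModuleCat.ofHom (groupRingLinearMap F hF'), ModuleCat.hom_ext (LinearMap.ext fun m => ?_)⟩
  have hk : s 1 ∈ ι.range := by rw [hexact, MonoidHom.mem_ker, hs]
  obtain ⟨k, hk⟩ := hk
  have h1 : ∀ m : M, F (c.single 1 m) = h' m := fun m => by
    rw [hF, ← hk, ← map_inv, hh', ← single_mul_smul, ← _root_.map_mul, mul_inv_cancel,
      _root_.map_one,
      single_one_smul]
  exact h1 m

theorem projective_functor_obj (P : ModuleCat.{0} A)
    (hP : Projective ((ModuleCat.restrictScalars ψ).obj P)) (hπι : ∀ k, π (ι k) = 1)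
    (hψ : ∀ k, c.toFun (ι k) 1 = ψ (MonoidAlgebra.single k 1))
    (hπ : Function.Surjective π) (hexact : ι.range = π.ker) :
    Projective (c.functor.obj P) where
  factors {E X} f e he := by
    have : Epi ((resFunctor ι).map e) := inferInstance
    obtain ⟨f', hf'⟩ := c.unit_comp_surjective ψ hπι hψ P E hπ hexact
      (Projective.factorThru (c.unit ψ hπι hψ P ≫ (resFunctor ι).map f) ((resFunctor ι).map e))
    refine ⟨f', c.unit_comp_injective ψ hπι hψ P X hπ ?_⟩
    dsimp only at hf' ⊢
    rw [Functor.map_comp, ← Category.assoc, hf', Projective.factorThru_comp]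

/-- The comparison between `Ext` over `G` of an induced module and `Ext` over `K`. -/
noncomputable def shapiro (M : ModuleCat.{0} A) (X : ModuleCat.{0} (MonoidAlgebra ℤ G)) (n : ℕ) :
    Ext (c.functor.obj M) X n →+
      Ext ((ModuleCat.restrictScalars ψ).obj M) ((resFunctor ι).obj X) n :=
  (extPre (c.unit ψ hπι hψ M) ((resFunctor ι).obj X) n).comp
    ((resFunctor ι).mapExtAddHom (c.functor.obj M) X n)

theorem shapiro_apply (M : ModuleCat.{0} A) (X : ModuleCat.{0} (MonoidAlgebra ℤ G)) (n : ℕ)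
    (e : Ext (c.functor.obj M) X n) :
    c.shapiro ψ hπι hψ M X n e = extPre (c.unit ψ hπι hψ M) ((resFunctor ι).obj X) n
      ((resFunctor ι).mapExtAddHom (c.functor.obj M) X n e) := rfl

theorem shapiro_mk₀ (M : ModuleCat.{0} A) (X : ModuleCat.{0} (MonoidAlgebra ℤ G))
    (f : c.functor.obj M ⟶ X) :
    c.shapiro ψ hπι hψ M X 0 (Ext.mk₀ f) =
      Ext.mk₀ (c.unit ψ hπι hψ M ≫ (resFunctor ι).map f) := by
  rw [shapiro_apply, Functor.mapExtAddHom_apply, Ext.mapExactFunctor_mk₀, extPre_mk₀]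

theorem shapiro_extPre {M N : ModuleCat.{0} A} (X : ModuleCat.{0} (MonoidAlgebra ℤ G)) (n : ℕ)
    (f : N ⟶ M) (e : Ext (c.functor.obj M) X n) :
    c.shapiro ψ hπι hψ N X n (extPre (c.functor.map f) X n e) =
      extPre ((ModuleCat.restrictScalars ψ).map f) _ n (c.shapiro ψ hπι hψ M X n e) := by
  rw [shapiro_apply, shapiro_apply, mapExtAddHom_extPre, ← extPre_comp, ← extPre_comp,
    unit_naturality]

theorem shapiro_extδ {S : ShortComplex (ModuleCat.{0} A)} (hS : S.ShortExact)
    (X : ModuleCat.{0} (MonoidAlgebra ℤ G)) (n : ℕ) (e : Ext (c.functor.obj S.X₁) X n) :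
    c.shapiro ψ hπι hψ S.X₃ X (n + 1) (extδ (c.shortExact_map hS) X n e) =
      extδ (hS.map_of_exact (ModuleCat.restrictScalars ψ)) _ n
        (c.shapiro ψ hπι hψ S.X₁ X n e) := by
  refine (congrArg (extPre (c.unit ψ hπι hψ S.X₃) ((resFunctor ι).obj X) (n + 1))
    (mapExtAddHom_extδ (resFunctor ι) (c.shortExact_map hS) e)).trans ?_
  exact extδ_naturality (hS.map_of_exact (ModuleCat.restrictScalars ψ))
    ((c.shortExact_map hS).map_of_exact (resFunctor ι))
    { τ₁ := c.unit ψ hπι hψ S.X₁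
      τ₂ := c.unit ψ hπι hψ S.X₂
      τ₃ := c.unit ψ hπι hψ S.X₃
      comm₁₂ := (c.unit_naturality ψ hπι hψ S.f).symm
      comm₂₃ := (c.unit_naturality ψ hπι hψ S.g).symm } _

/-- A module is a quotient of a projective module. -/
theorem exists_shortExact_projective {R : Type} [Ring R] (M : ModuleCat.{0} R) :
    ∃ (B P : ModuleCat.{0} R) (i : B ⟶ P) (p : P ⟶ M) (w : i ≫ p = 0),
      (ShortComplex.mk i p w).ShortExact ∧ Projective P := by
  have hsurj : Function.Surjective (Finsupp.linearCombination R (id : M → M)) := fun m =>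
    ⟨Finsupp.single m 1, by simp⟩
  exact ⟨_, _, _, _, _, LinearMap.shortExact_shortComplexKer hsurj,
    (IsProjective.iff_projective _).1 inferInstance⟩

theorem shapiro_bijective (hA : ∀ P : ModuleCat.{0} A, Projective P →
      Projective ((ModuleCat.restrictScalars ψ).obj P))
    (hπ : Function.Surjective π) (hexact : ι.range = π.ker)
    (X : ModuleCat.{0} (MonoidAlgebra ℤ G)) (n : ℕ) (M : ModuleCat.{0} A) :
    Function.Bijective (c.shapiro ψ hπι hψ M X n) := by
  induction n generalizing M with
  | zero =>
    have h1 : Function.Bijective (c.shapiro ψ hπι hψ M X 0 ∘ Ext.mk₀) := by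
      have : c.shapiro ψ hπι hψ M X 0 ∘ Ext.mk₀ = Ext.mk₀ ∘ fun f : c.functor.obj M ⟶ X =>
          c.unit ψ hπι hψ M ≫ (resFunctor ι).map f :=
        funext fun f => c.shapiro_mk₀ ψ hπι hψ M X f
      rw [this]
      exact (Ext.mk₀_bijective _ _).comp ⟨c.unit_comp_injective ψ hπι hψ M X hπ,
        c.unit_comp_surjective ψ hπι hψ M X hπ hexact⟩
    exact (Function.Bijective.of_comp_iff _ (Ext.mk₀_bijective _ _)).1 h1
  | succ n ih =>
    obtain ⟨B, P, i, p, w, hS, hP⟩ := exists_shortExact_projective M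
    have hP1 := hA P hP
    have hP2 := c.projective_functor_obj ψ P hP1 hπι hψ hπ hexact
    have hS1 := hS.map_of_exact (ModuleCat.restrictScalars ψ)
    have hS2 := c.shortExact_map hS
    constructor
    · rw [injective_iff_map_eq_zero]
      intro e he
      obtain ⟨e, rfl⟩ := extδ_surjective hS2 X n
        (Ext.subsingleton_of_projective (c.functor.obj P) _ _) e
      have h0 := (c.shapiro_extδ ψ hπι hψ hS X n e).symm.trans he
      obtain ⟨y, hy⟩ := (extδ_eq_zero_iff hS1 _).1 h0
      obtain ⟨y, rfl⟩ := (ih P).2 y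
      refine (extδ_eq_zero_iff hS2 _).2 ⟨y, (ih B).1 ?_⟩
      exact (c.shapiro_extPre ψ hπι hψ X n i y).trans hy
    · intro e
      obtain ⟨e, rfl⟩ := extδ_surjective hS1 _ n
        (Ext.subsingleton_of_projective ((ModuleCat.restrictScalars ψ).obj P) _ _) e
      obtain ⟨e, rfl⟩ := (ih B).2 e
      exact ⟨extδ hS2 X n e, c.shapiro_extδ ψ hπι hψ hS X n e⟩

end TranslationCocycle

section GroupRingHom

variable {G : Type}

/-- The additive map out of the group ring with given values on group elements. -/
noncomputable def groupRingLift {N : Type} [AddCommGroup N] (f : G → N) :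
    MonoidAlgebra ℤ G →+ N :=
  (Finsupp.liftAddHom fun g => (zmultiplesHom N (f g))).comp
    MonoidAlgebra.coeffAddEquiv.toAddMonoidHom

theorem groupRingLift_single {N : Type} [AddCommGroup N] (f : G → N) (g : G) :
    groupRingLift f (MonoidAlgebra.single g 1) = f g := by
  simp [groupRingLift]

theorem groupRing_addHom_ext {N : Type} [AddCommGroup N] {f f' : MonoidAlgebra ℤ G →+ N}
    (h : ∀ g, f (MonoidAlgebra.single g 1) = f' (MonoidAlgebra.single g 1)) : f = f' := by
  refine AddMonoidHom.ext fun x => ?_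
  induction x using MonoidAlgebra.induction_linear with
  | zero => simp
  | add x y hx hy => rw [map_add, map_add, hx, hy]
  | single g r =>
    have : MonoidAlgebra.single g r = r • MonoidAlgebra.single g (1 : ℤ) := by
      simp [MonoidAlgebra.smul_single]
    rw [this, map_zsmul, map_zsmul, h]

theorem groupRing_addHom_congr {N : Type} [AddCommGroup N] (f f' : MonoidAlgebra ℤ G →+ N)
    (h : ∀ g, f (MonoidAlgebra.single g 1) = f' (MonoidAlgebra.single g 1))
    (x : MonoidAlgebra ℤ G) : f x = f' x :=
  DFunLike.congr_fun (groupRing_addHom_ext h) x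

end GroupRingHom

section Cosets

variable {K G Q : Type} [Group K] [Group G] [Group Q] (ι : K →* G) (π : G →* Q)

theorem exists_normalized_section (hπ : Function.Surjective π) :
    ∃ s : Q → G, (∀ q, π (s q) = q) ∧ s 1 = 1 := by
  classical
  choose s hs using hπ
  refine ⟨Function.update s 1 1, fun q => ?_, by simp⟩
  by_cases h : q = 1
  · subst h; simp
  · simp [h, hs]

/-- The group ring, restricted along a group homomorphism. -/
noncomputable abbrev resRing : ModuleCat.{0} (MonoidAlgebra ℤ K) :=
  (resFunctor ι).obj (ModuleCat.of _ (MonoidAlgebra ℤ G))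

theorem resRing_single_smul (k : K) (x : MonoidAlgebra ℤ G) :
    MonoidAlgebra.single k (1 : ℤ) • (show resRing ι from x) =
      MonoidAlgebra.single (ι k) (1 : ℤ) * x :=
  resFunctor_single_smul ι (ModuleCat.of _ (MonoidAlgebra ℤ G)) k x

/-- A linear map out of the restricted group ring, given by its values on group elements. -/
noncomputable def resRingLift {N : Type} [AddCommGroup N] [Module (MonoidAlgebra ℤ K) N]
    (f : G → N) (hf : ∀ k g, f (ι k * g) = MonoidAlgebra.single k (1 : ℤ) • f g) :
    resRing ι →ₗ[MonoidAlgebra ℤ K] N :=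
  groupRingLinearMap (M := resRing ι) (groupRingLift f) fun k x =>
    (congrArg (groupRingLift f) (resRing_single_smul ι k x)).trans
      (groupRing_addHom_congr
        ((groupRingLift f).comp (AddMonoidHom.mulLeft (MonoidAlgebra.single (ι k) (1 : ℤ))))
        ((DistribSMul.toAddMonoidHom N (MonoidAlgebra.single k (1 : ℤ))).comp (groupRingLift f))
        (fun g => by simp [MonoidAlgebra.single_mul_single, groupRingLift_single, hf]) x)

theorem resRingLift_single {N : Type} [AddCommGroup N] [Module (MonoidAlgebra ℤ K) N]
    (f : G → N) (hf : ∀ k g, f (ι k * g) = MonoidAlgebra.single k (1 : ℤ) • f g) (g : G) :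
    resRingLift ι f hf (show resRing ι from MonoidAlgebra.single g (1 : ℤ)) = f g :=
  groupRingLift_single f g

theorem resRing_linearMap_ext {N : Type} [AddCommGroup N] [Module (MonoidAlgebra ℤ K) N]
    {f f' : resRing ι →ₗ[MonoidAlgebra ℤ K] N}
    (h : ∀ g : G, f (show resRing ι from MonoidAlgebra.single g (1 : ℤ)) =
      f' (show resRing ι from MonoidAlgebra.single g (1 : ℤ))) : f = f' :=
  LinearMap.ext (groupRing_addHom_congr f.toAddMonoidHom f'.toAddMonoidHom h)

open Classical in
theorem ite_single_mul (hπι : ∀ k, π (ι k) = 1) (q : Q) (k : K) (g : G) :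
    (if π (ι k * g) = q then (MonoidAlgebra.single (ι k * g) 1 : MonoidAlgebra ℤ G) else 0) =
      MonoidAlgebra.single (ι k) (1 : ℤ) * if π g = q then MonoidAlgebra.single g 1 else 0 := by
  rw [_root_.map_mul, hπι, one_mul]
  split_ifs
  · rw [MonoidAlgebra.single_mul_single, one_mul]
  · rw [mul_zero]

open Classical in
/-- The projection of the group ring to the span of a fibre of `π`. -/
noncomputable def fibreProj (hπι : ∀ k, π (ι k) = 1) (q : Q) : resRing ι ⟶ resRing ι :=
  ModuleCat.ofHom (X := resRing ι) (Y := resRing ι) (resRingLift ι (N := resRing ι)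
    (fun g => if π g = q then (MonoidAlgebra.single g 1 : MonoidAlgebra ℤ G) else 0)
    fun k g => (ite_single_mul ι π hπι q k g).trans (resRing_single_smul ι k _).symm)

open Classical in
theorem fibreProj_single (hπι : ∀ k, π (ι k) = 1) (q : Q) (g : G) :
    fibreProj ι π hπι q (show resRing ι from MonoidAlgebra.single g (1 : ℤ)) =
      if π g = q then (MonoidAlgebra.single g 1 : MonoidAlgebra ℤ G) else 0 :=
  resRingLift_single ι (N := resRing ι)
    (fun g => if π g = q then (MonoidAlgebra.single g 1 : MonoidAlgebra ℤ G) else 0)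
    (fun k g => (ite_single_mul ι π hπι q k g).trans (resRing_single_smul ι k _).symm) g

theorem fibreProj_comp_self (hπι : ∀ k, π (ι k) = 1) (q : Q) :
    fibreProj ι π hπι q ≫ fibreProj ι π hπι q = fibreProj ι π hπι q := by
  classical
  refine ModuleCat.hom_ext (resRing_linearMap_ext ι fun g => ?_)
  refine (congrArg (fibreProj ι π hπι q) (fibreProj_single ι π hπι q g)).trans
    (Eq.trans ?_ (fibreProj_single ι π hπι q g).symm)
  split_ifs with h
  · exact (fibreProj_single ι π hπι q g).trans (if_pos h)
  · exact map_zero (fibreProj ι π hπι q).hom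

theorem fibreProj_comp_of_ne (hπι : ∀ k, π (ι k) = 1) {q q' : Q} (hq : q ≠ q') :
    fibreProj ι π hπι q ≫ fibreProj ι π hπι q' = 0 := by
  classical
  refine ModuleCat.hom_ext (resRing_linearMap_ext ι fun g => ?_)
  refine (congrArg (fibreProj ι π hπι q') (fibreProj_single ι π hπι q g)).trans ?_
  split_ifs with h
  · exact (fibreProj_single ι π hπι q' g).trans (if_neg fun h' => hq (h.symm.trans h'))
  · exact map_zero (fibreProj ι π hπι q').hom

theorem fibreProj_mul (hπι : ∀ k, π (ι k) = 1) (q : Q) (g : G) (x : MonoidAlgebra ℤ G) :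
    (show MonoidAlgebra ℤ G from fibreProj ι π hπι (π g * q)
      (show resRing ι from MonoidAlgebra.single g (1 : ℤ) * x)) =
      MonoidAlgebra.single g (1 : ℤ) * (show MonoidAlgebra ℤ G from fibreProj ι π hπι q x) := by
  classical
  refine groupRing_addHom_congr
    (((fibreProj ι π hπι (π g * q)).hom.toAddMonoidHom :
        MonoidAlgebra ℤ G →+ MonoidAlgebra ℤ G).comp
      (AddMonoidHom.mulLeft (MonoidAlgebra.single g (1 : ℤ))))
    ((AddMonoidHom.mulLeft (MonoidAlgebra.single g (1 : ℤ))).comp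
      ((fibreProj ι π hπι q).hom.toAddMonoidHom : MonoidAlgebra ℤ G →+ MonoidAlgebra ℤ G))
    (fun h => ?_) x
  have h1 : (MonoidAlgebra.single g (1 : ℤ) * MonoidAlgebra.single h 1 : MonoidAlgebra ℤ G) =
      MonoidAlgebra.single (g * h) 1 := by rw [MonoidAlgebra.single_mul_single, one_mul]
  refine (congrArg (fibreProj ι π hπι (π g * q)) h1).trans
    ((fibreProj_single ι π hπι _ _).trans ?_)
  refine Eq.trans ?_ (congrArg (MonoidAlgebra.single g (1 : ℤ) * ·)
    (fibreProj_single ι π hπι q h)).symm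
  simp only [_root_.map_mul, mul_right_inj]
  split_ifs
  · exact h1.symm
  · exact (mul_zero (MonoidAlgebra.single g (1 : ℤ))).symm

theorem fibreProj_sum_eq_self (hπι : ∀ k, π (ι k) = 1) (x : resRing ι) :
    ∃ s : Finset Q, ∀ s', s ⊆ s' → ∑ q ∈ s', fibreProj ι π hπι q x = x := by
  classical
  have key : ∀ (g : G) (r : ℤ), ∃ s : Finset Q, ∀ s', s ⊆ s' →
      ∑ q ∈ s', fibreProj ι π hπι q
        (show resRing ι from (r • MonoidAlgebra.single g 1 : MonoidAlgebra ℤ G)) =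
        (show resRing ι from (r • MonoidAlgebra.single g 1 : MonoidAlgebra ℤ G)) := by
    intro g r
    refine ⟨{π g}, fun s' hs' => ?_⟩
    have h1 : ∀ q, fibreProj ι π hπι q
        (show resRing ι from (r • MonoidAlgebra.single g 1 : MonoidAlgebra ℤ G)) =
        (if π g = q then (r • MonoidAlgebra.single g 1 : MonoidAlgebra ℤ G) else 0) := by
      intro q
      refine (map_zsmul (fibreProj ι π hπι q).hom r _).trans
        ((congrArg (r • ·) (fibreProj_single ι π hπι q g)).trans ?_)
      split_ifs
      · rfl
      · exact smul_zero r
    refine (Finset.sum_congr rfl fun q _ => h1 q).trans ?_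
    exact (Finset.sum_ite_eq s' (π g) _).trans (if_pos (hs' (Finset.mem_singleton_self _)))
  have main : ∀ x : MonoidAlgebra ℤ G, ∃ s : Finset Q, ∀ s', s ⊆ s' →
      ∑ q ∈ s', fibreProj ι π hπι q (show resRing ι from x) = (show resRing ι from x) := by
    intro x
    induction x using MonoidAlgebra.induction_linear with
    | zero =>
      exact ⟨∅, fun s' _ => Finset.sum_eq_zero fun q _ => map_zero (fibreProj ι π hπι q).hom⟩
    | add x y hx hy =>
      obtain ⟨s, hs⟩ := hx
      obtain ⟨t, ht⟩ := hy
      refine ⟨s ∪ t, fun s' hs' => ?_⟩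
      refine (Finset.sum_congr rfl fun q _ => map_add (fibreProj ι π hπι q).hom x y).trans ?_
      refine Finset.sum_add_distrib.trans (congrArg₂ (· + ·)
        (hs s' (Finset.union_subset_left hs')) (ht s' (Finset.union_subset_right hs')))
    | single g r =>
      have : MonoidAlgebra.single g r = r • MonoidAlgebra.single g (1 : ℤ) := by
        simp [MonoidAlgebra.smul_single]
      rw [this]
      exact key g r
  exact main x

variable {π}

theorem exists_coset_equivariant (hι : Function.Injective ι) (hexact : ι.range = π.ker)
    {s : Q → G} (hs : ∀ q, π (s q) = q) :
    ∃ κ : G → K, (∀ g, ι (κ g) * s (π g) = g) ∧ ∀ k g, κ (ι k * g) = k * κ g := by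
  have hπι : ∀ k, π (ι k) = 1 := fun k => by
    rw [← MonoidHom.mem_ker, ← hexact]; exact ⟨k, rfl⟩
  have h : ∀ g, ∃ k, ι k = g * (s (π g))⁻¹ := fun g => by
    have : g * (s (π g))⁻¹ ∈ ι.range := by rw [hexact, MonoidHom.mem_ker]; simp [hs]
    exact this
  choose κ hκ using h
  refine ⟨κ, fun g => by rw [hκ]; group, fun k g => hι ?_⟩
  rw [hκ, _root_.map_mul, _root_.map_mul, hκ, hπι, one_mul, mul_assoc]

theorem exists_fibreProj_factorization (hπι : ∀ k, π (ι k) = 1) (hι : Function.Injective ι)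
    (hπ : Function.Surjective π) (hexact : ι.range = π.ker) (q : Q) :
    ∃ (p : resRing ι ⟶ ModuleCat.of _ (MonoidAlgebra ℤ K))
      (i : ModuleCat.of _ (MonoidAlgebra ℤ K) ⟶ resRing ι),
      p ≫ i = fibreProj ι π hπι q ∧ i ≫ p = 𝟙 _ := by
  classical
  obtain ⟨s, hs, -⟩ := exists_normalized_section π hπ
  obtain ⟨κ, hκ, hκ'⟩ := exists_coset_equivariant ι hι hexact hs
  let p : resRing ι →ₗ[MonoidAlgebra ℤ K] MonoidAlgebra ℤ K := resRingLift ι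
    (fun g => if π g = q then MonoidAlgebra.single (κ g) 1 else 0) fun k g => by
      simp only [_root_.map_mul, hπι, one_mul, hκ']
      split_ifs <;> simp [MonoidAlgebra.single_mul_single]
  let i : MonoidAlgebra ℤ K →ₗ[MonoidAlgebra ℤ K] resRing ι :=
    LinearMap.toSpanSingleton _ _
      (show resRing ι from (MonoidAlgebra.single (s q) 1 : MonoidAlgebra ℤ G))
  have hp : ∀ g : G, p (show resRing ι from MonoidAlgebra.single g (1 : ℤ)) =
      if π g = q then MonoidAlgebra.single (κ g) 1 else 0 := resRingLift_single ι _ _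
  have hi : ∀ k : K, i (MonoidAlgebra.single k 1) =
      (show resRing ι from (MonoidAlgebra.single (ι k * s q) 1 : MonoidAlgebra ℤ G)) := fun k =>
    (resRing_single_smul ι k _).trans (by rw [MonoidAlgebra.single_mul_single, one_mul])
  have hip : ∀ x, p (i x) = x := groupRing_addHom_congr
    ((p ∘ₗ i).toAddMonoidHom) (AddMonoidHom.id _) fun k => by
      refine (congrArg p (hi k)).trans ((hp _).trans ?_)
      rw [_root_.map_mul, hπι, one_mul, hs, if_pos rfl, AddMonoidHom.id_apply]
      have : κ (ι k * s q) = k := hι (by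
        have := hκ (ι k * s q)
        rwa [_root_.map_mul, hπι, one_mul, hs, mul_left_inj] at this)
      rw [this]
  refine ⟨ModuleCat.ofHom (X := resRing ι) p, ModuleCat.ofHom (Y := resRing ι) i,
    ModuleCat.hom_ext (resRing_linearMap_ext ι fun g => ?_),
    ModuleCat.hom_ext (LinearMap.ext hip)⟩
  refine (congrArg i (hp g)).trans (Eq.trans ?_ (fibreProj_single ι π hπι q g).symm)
  split_ifs with h
  · refine (hi _).trans ?_
    rw [← h, hκ]
  · exact map_zero i

theorem projective_resRing (hι : Function.Injective ι) (hπ : Function.Surjective π)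
    (hexact : ι.range = π.ker) : Module.Projective (MonoidAlgebra ℤ K) (resRing ι) := by
  obtain ⟨s, hs, -⟩ := exists_normalized_section π hπ
  obtain ⟨κ, hκ, hκ'⟩ := exists_coset_equivariant ι hι hexact hs
  have hπι : ∀ k, π (ι k) = 1 := fun k => by
    rw [← MonoidHom.mem_ker, ← hexact]; exact ⟨k, rfl⟩
  let p : resRing ι →ₗ[MonoidAlgebra ℤ K] (Q →₀ MonoidAlgebra ℤ K) := resRingLift ι
    (fun g => Finsupp.single (π g) (MonoidAlgebra.single (κ g) 1)) fun k g => by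
      simp only [_root_.map_mul, hπι, one_mul, hκ', Finsupp.smul_single, smul_eq_mul,
        MonoidAlgebra.single_mul_single]
  let i : (Q →₀ MonoidAlgebra ℤ K) →ₗ[MonoidAlgebra ℤ K] resRing ι :=
    Finsupp.linearCombination _ fun q =>
      (show resRing ι from (MonoidAlgebra.single (s q) 1 : MonoidAlgebra ℤ G))
  refine Module.Projective.of_split p i (resRing_linearMap_ext ι fun g => ?_)
  refine (congrArg i (resRingLift_single ι _ _ g)).trans
    ((Finsupp.linearCombination_single _ _ _).trans ?_)
  refine (resRing_single_smul ι (κ g) _).trans ?_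
  rw [MonoidAlgebra.single_mul_single, hκ, one_mul]
  rfl

theorem projective_resFunctor_obj (hι : Function.Injective ι) (hπ : Function.Surjective π)
    (hexact : ι.range = π.ker) (P : ModuleCat.{0} (MonoidAlgebra ℤ G)) (hP : Projective P) :
    Projective ((resFunctor ι).obj P) := by
  have hR : Projective (resRing ι) :=
    (IsProjective.iff_projective (resRing ι)).1 (projective_resRing ι hι hπ hexact)
  have : (ModuleCat.coextendScalars (MonoidAlgebra.mapDomainRingHom ℤ ι)).PreservesEpimorphisms :=
    { preserves := fun {X Y} f hf => by
        rw [ModuleCat.epi_iff_surjective]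
        intro y
        let y' : resRing ι ⟶ Y :=
          ModuleCat.ofHom (X := resRing ι) (ModuleCat.CoextendScalars.equiv _ _ y)
        refine ⟨(ModuleCat.CoextendScalars.equiv _ _).symm (Projective.factorThru y' f).hom, ?_⟩
        refine ModuleCat.CoextendScalars.ext (LinearMap.ext fun z => ?_)
        exact LinearMap.congr_fun (congrArg ModuleCat.Hom.hom (Projective.factorThru_comp y' f)) z }
  exact (ModuleCat.restrictCoextendScalarsAdj _).map_projective P hP

end Cosets

namespace TranslationCocycle

open Abelian

section

variable {G Q : Type} [Group G] [Group Q] {π : G →* Q} {A : Type} [Ring A]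
  (c : TranslationCocycle π A)

theorem exists_iso_res_ring (M : ModuleCat.{0} A) (e : M ≃+ ℤ)
    (h : ∀ g q (m : M), c.toFun g q • m = m) :
    ∃ θ : c.functor.obj M ≅ (resFunctor π).obj (ModuleCat.of _ (MonoidAlgebra ℤ Q)),
      ∀ q (m : M), θ.hom (show c.functor.obj M from c.single q m) =
        (show MonoidAlgebra ℤ Q from MonoidAlgebra.single q (e m)) := by
  let E : c.Carrier M ≃+ MonoidAlgebra ℤ Q :=
    (Finsupp.mapRange.addEquiv (ι := Q) e).trans MonoidAlgebra.coeffAddEquiv.symm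
  have hE : ∀ q m, E (c.single q m) = MonoidAlgebra.single q (e m) := fun q m => by
    refine (congrArg MonoidAlgebra.coeffAddEquiv.symm
      (Finsupp.mapRange_single (hf := map_zero e) (a := q) (b := m))).trans ?_
    rfl
  let f : c.Carrier M →ₗ[MonoidAlgebra ℤ G]
      (resFunctor π).obj (ModuleCat.of _ (MonoidAlgebra ℤ Q)) :=
    groupRingLinearMap (N := (resFunctor π).obj (ModuleCat.of _ (MonoidAlgebra ℤ Q)))
      E.toAddMonoidHom fun g x => by
      refine Eq.trans ?_ (resRing_single_smul π g _).symm
      refine c.hom_congr (E.toAddMonoidHom.comp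
        (DistribSMul.toAddMonoidHom _ (MonoidAlgebra.single g (1 : ℤ))))
        ((AddMonoidHom.mulLeft (MonoidAlgebra.single (π g) (1 : ℤ))).comp E.toAddMonoidHom) ?_ x
      intro q m
      simp only [AddMonoidHom.comp_apply, DistribSMul.toAddMonoidHom_apply,
        AddMonoidHom.coe_mulLeft, AddEquiv.toAddMonoidHom_eq_coe, AddMonoidHom.coe_coe]
      rw [single_smul_single, hE, hE, h, MonoidAlgebra.single_mul_single, one_mul]
  exact ⟨(LinearEquiv.ofBijective f E.bijective).toModuleIso, hE⟩

end

variable {K G Q : Type} [Group K] [Group G] [Group Q] {ι : K →* G} (π : G →* Q)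

/-- The cocycle for which induction is the diagonal tensor product with `ℤ[Q]`. -/
noncomputable def diag : TranslationCocycle π (MonoidAlgebra ℤ G) where
  toFun g _ := MonoidAlgebra.single g 1
  map_one _ := rfl
  map_mul g h _ := by rw [MonoidAlgebra.single_mul_single, one_mul]

theorem diag_ι (k : K) : (diag π).toFun (ι k) 1 =
    MonoidAlgebra.mapDomainRingHom ℤ ι (MonoidAlgebra.single k 1) := by
  rw [MonoidAlgebra.mapDomainRingHom_apply, MonoidAlgebra.mapDomain_single]
  rfl

/-- Right translation by an element of `Q`. -/
noncomputable def translate (q : Q) (M : ModuleCat.{0} (MonoidAlgebra ℤ G)) :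
    (diag π).functor.obj M ⟶ (diag π).functor.obj M :=
  ModuleCat.ofHom (groupRingLinearMap ((diag π).lift fun q' => (diag π).single (q' * q)) fun g x =>
    (diag π).hom_congr (((diag π).lift fun q' => (diag π).single (q' * q)).comp
      (DistribSMul.toAddMonoidHom _ (MonoidAlgebra.single g (1 : ℤ))))
      ((DistribSMul.toAddMonoidHom _ (MonoidAlgebra.single g (1 : ℤ))).comp
      ((diag π).lift fun q' => (diag π).single (q' * q)))
      (fun q' m => by
        simp only [AddMonoidHom.comp_apply, DistribSMul.toAddMonoidHom_apply, lift_single,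
          single_smul_single, mul_assoc]
        rfl) x)

theorem translate_single (q q' : Q) (M : ModuleCat.{0} (MonoidAlgebra ℤ G)) (m : M) :
    translate π q M (show (diag π).functor.obj M from (diag π).single q' m) =
      (show (diag π).functor.obj M from (diag π).single (q' * q) m) :=
  (diag π).lift_single _ _ _

theorem translate_naturality (q : Q) {M N : ModuleCat.{0} (MonoidAlgebra ℤ G)} (f : M ⟶ N) :
    translate π q M ≫ (diag π).functor.map f = (diag π).functor.map f ≫ translate π q N := by
  refine ModuleCat.hom_ext ((diag π).linearMap_ext fun q' m => ?_)
  refine (congrArg ((diag π).functor.map f) (translate_single π q q' M m)).trans ?_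
  refine ((diag π).mapHom_single f.hom _ _).trans ?_
  refine Eq.trans ?_ (congrArg (translate π q N) ((diag π).mapHom_single f.hom q' m)).symm
  exact (translate_single π q q' N _).symm

variable (hπι : ∀ k, π (ι k) = 1)

/-- The Shapiro comparison for the diagonal tensor product. -/
noncomputable abbrev diagShapiro (M X : ModuleCat.{0} (MonoidAlgebra ℤ G)) (n : ℕ) :
    Ext ((diag π).functor.obj M) X n →+ Ext ((resFunctor ι).obj M) ((resFunctor ι).obj X) n :=
  (diag π).shapiro (MonoidAlgebra.mapDomainRingHom ℤ ι) hπι (diag_ι π) M X n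

theorem diagShapiro_bijective (hι : Function.Injective ι) (hπ : Function.Surjective π)
    (hexact : ι.range = π.ker) (M X : ModuleCat.{0} (MonoidAlgebra ℤ G)) (n : ℕ) :
    Function.Bijective (diagShapiro π hπι M X n) :=
  (diag π).shapiro_bijective _ hπι _ (projective_resFunctor_obj ι hι hπ hexact) hπ hexact X n M

theorem diagShapiro_translate (hι : Function.Injective ι) (hπ : Function.Surjective π)
    (hexact : ι.range = π.ker) (q q' : Q) (n : ℕ) (M : ModuleCat.{0} (MonoidAlgebra ℤ G))
    (e e₁ : Ext ((diag π).functor.obj M) (ModuleCat.of _ (MonoidAlgebra ℤ G)) n)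
    (h : diagShapiro π hπι M _ n e₁ =
      extPost _ (fibreProj ι π hπι q') n (diagShapiro π hπι M _ n e)) :
    diagShapiro π hπι M _ n (extPre (translate π q M) _ n e₁) =
      extPost _ (fibreProj ι π hπι (q * q')) n
        (diagShapiro π hπι M _ n (extPre (translate π q M) _ n e)) := by
  induction n generalizing M with
  | zero =>
    obtain ⟨f, rfl⟩ := (Ext.mk₀_bijective _ _).2 e
    obtain ⟨f₁, rfl⟩ := (Ext.mk₀_bijective _ _).2 e₁
    rw [extPre_mk₀, extPre_mk₀]
    rw [diagShapiro, shapiro_mk₀, shapiro_mk₀, extPost_mk₀] at h ⊢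
    have h1 : ∀ m : M, f₁ (show (diag π).functor.obj M from (diag π).single 1 m) =
        fibreProj ι π hπι q' (f (show (diag π).functor.obj M from (diag π).single 1 m)) := fun m =>
      LinearMap.congr_fun (congrArg ModuleCat.Hom.hom ((Ext.mk₀_bijective _ _).1 h)) m
    refine congrArg Ext.mk₀ (ModuleCat.hom_ext (LinearMap.ext fun m => ?_))
    obtain ⟨g, rfl⟩ := hπ q
    have h2 : ∀ m : M, ∃ m' : M, (show (diag π).functor.obj M from (diag π).single (π g) m) =
        MonoidAlgebra.single g (1 : ℤ) • (show (diag π).functor.obj M from (diag π).single 1 m') :=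
      fun m => ⟨MonoidAlgebra.single g⁻¹ (1 : ℤ) • m, by
        refine Eq.trans ?_ ((diag π).single_smul_single _ _ _).symm
        rw [mul_one]
        refine congrArg ((diag π).single (π g)) ?_
        refine Eq.trans ?_ (single_mul_smul g g⁻¹ m)
        rw [mul_inv_cancel, single_one_smul]⟩
    have h3 : ∀ m : M, f₁ (show (diag π).functor.obj M from (diag π).single (π g) m) =
        fibreProj ι π hπι (π g * q')
          (f (show (diag π).functor.obj M from (diag π).single (π g) m)) := by
      intro m
      obtain ⟨m', hm'⟩ := h2 m
      rw [hm']
      refine (map_smul f₁.hom _ _).trans ?_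
      refine Eq.trans ?_ (congrArg (fibreProj ι π hπι (π g * q')) (map_smul f.hom _ _)).symm
      refine Eq.trans ?_ (fibreProj_mul ι π hπι q' g _).symm
      exact congrArg (MonoidAlgebra.single g (1 : ℤ) * ·) (h1 m')
    have h4 : ∀ m : M, translate π (π g) M (show (diag π).functor.obj M from (diag π).single 1 m) =
        (show (diag π).functor.obj M from (diag π).single (π g) m) := fun m => by
      rw [translate_single, one_mul]
    refine (congrArg f₁ (h4 m)).trans ((h3 m).trans ?_)
    exact (congrArg (fun z => fibreProj ι π hπι (π g * q') (f z)) (h4 m)).symm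
  | succ n ih =>
    obtain ⟨B, P, i, p, w, hS, hP⟩ := exists_shortExact_projective M
    have hP1 := projective_resFunctor_obj ι hι hπ hexact P hP
    have hP2 := (diag π).projective_functor_obj (MonoidAlgebra.mapDomainRingHom ℤ ι) P hP1 hπι
      (diag_ι π) hπ hexact
    have hS2 := (diag π).shortExact_map hS
    have hS1 := hS.map_of_exact (resFunctor ι)
    obtain ⟨e, rfl⟩ := extδ_surjective hS2 _ n
        (Ext.subsingleton_of_projective ((diag π).functor.obj P) _ _) e
    obtain ⟨e', he'⟩ := (diagShapiro_bijective π hπι hι hπ hexact B _ n).2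
      (extPost _ (fibreProj ι π hπι q') n (diagShapiro π hπι B _ n e))
    have hδ := fun x => (diag π).shapiro_extδ (MonoidAlgebra.mapDomainRingHom ℤ ι) hπι (diag_ι π)
      hS (ModuleCat.of _ (MonoidAlgebra ℤ G)) n x
    have hnat := fun x => extδ_naturality (Y := ModuleCat.of _ (MonoidAlgebra ℤ G)) (n := n) hS2 hS2
      { τ₁ := translate π q B
        τ₂ := translate π q P
        τ₃ := translate π q M
        comm₁₂ := translate_naturality π q i
        comm₂₃ := translate_naturality π q p } x
    have h5 : e₁ = extδ hS2 _ n e' := by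
      refine (diagShapiro_bijective π hπι hι hπ hexact M _ (n + 1)).1 (h.trans ?_)
      refine Eq.trans ?_ (hδ e').symm
      refine Eq.trans ?_ (congrArg (extδ hS1 _ n) he').symm
      refine (congrArg (extPost _ _ _) (hδ e)).trans ?_
      exact (extδ_extPost hS1 _ _).symm
    subst h5
    have key := fun x => (congrArg (diagShapiro π hπι M _ (n + 1)) (hnat x)).trans (hδ _)
    refine (key e').trans ?_
    refine Eq.trans ?_ (congrArg (extPost _ _ _) (key e)).symm
    refine Eq.trans ?_ (extδ_extPost hS1 _ _)
    exact congrArg (extδ hS1 _ n) (ih B e e' he')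

end TranslationCocycle

section TrivialModule

variable {G : Type} [Group G]

theorem nonempty_trivialGroupRingModule_addEquiv (G : Type) [Group G] :
    Nonempty (trivialGroupRingModule G ≃+ ℤ) :=
  ⟨(Representation.asModuleEquiv (Rep.trivial ℤ G ℤ).ρ).toAddEquiv⟩

theorem single_smul_trivialGroupRingModule (g : G) (z : trivialGroupRingModule G) :
    MonoidAlgebra.single g (1 : ℤ) • z = z := by
  have h : ∀ z : (Rep.trivial ℤ G ℤ).ρ.asModule, MonoidAlgebra.single g (1 : ℤ) • z = z := by
    intro z
    apply (Representation.asModuleEquiv (Rep.trivial ℤ G ℤ).ρ).injective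
    rw [Representation.asModuleEquiv_map_smul, Representation.asAlgebraHom_single, one_smul]
    rfl
  exact h z

theorem nonempty_iso_of_single_smul_eq_self {M N : ModuleCat.{0} (MonoidAlgebra ℤ G)}
    (hM : Nonempty (M ≃+ ℤ)) (hN : Nonempty (N ≃+ ℤ))
    (hM' : ∀ (g : G) (m : M), MonoidAlgebra.single g (1 : ℤ) • m = m)
    (hN' : ∀ (g : G) (m : N), MonoidAlgebra.single g (1 : ℤ) • m = m) : Nonempty (M ≅ N) := by
  obtain ⟨e⟩ := hM
  obtain ⟨e'⟩ := hN
  let E : M ≃+ N := e.trans e'.symm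
  exact ⟨(LinearEquiv.ofBijective (groupRingLinearMap E.toAddMonoidHom fun g m => by
    rw [hM', hN']) E.bijective).toModuleIso⟩

theorem nonempty_res_trivial_iso {K : Type} [Group K] (ι : K →* G) :
    Nonempty ((resFunctor ι).obj (trivialGroupRingModule G) ≅ trivialGroupRingModule K) :=
  nonempty_iso_of_single_smul_eq_self (nonempty_trivialGroupRingModule_addEquiv G)
    (nonempty_trivialGroupRingModule_addEquiv K)
    (fun k m => (resFunctor_single_smul ι _ k m).trans (single_smul_trivialGroupRingModule _ _))
    single_smul_trivialGroupRingModule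

end TrivialModule

theorem extCongr_refl_apply {C : Type*} [Category* C] [Abelian C] [HasExt.{0} C]
    {X X' Y : C}
    (f : X' ≅ X) {n : ℕ} (e : Abelian.Ext X Y n) :
    extCongr f (Iso.refl Y) n e = extPre f.hom Y n e :=
  congrArg (extPre f.hom Y n) (extPost_id e)

/-- A module over the group ring which is the direct sum of the translates of an infinite cyclic
group is free of rank one. -/
theorem nonempty_linearEquiv_of_decomposition {Q T : Type} [Group Q] [AddCommGroup T]
    [Module (MonoidAlgebra ℤ Q) T] (τ : Q → T →+ T) (hself : ∀ q e, τ q (τ q e) = τ q e)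
    (hne : ∀ q q', q ≠ q' → ∀ e, τ q' (τ q e) = 0)
    (hsum : ∀ e, ∃ s : Finset Q, ∑ q ∈ s, τ q e = e)
    (hsmul : ∀ q q' e, MonoidAlgebra.single q (1 : ℤ) • τ q' e =
      τ (q * q') (MonoidAlgebra.single q (1 : ℤ) • e))
    (α : ℤ →+ T) (hα : Function.Injective α) (hr : ∀ e, τ 1 e = e ↔ ∃ z, α z = e) :
    Nonempty (MonoidAlgebra ℤ Q ≃ₗ[MonoidAlgebra ℤ Q] T) := by
  classical
  have hu : τ 1 (α 1) = α 1 := (hr _).2 ⟨1, rfl⟩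
  have hz : ∀ z : ℤ, α z = z • α 1 := fun z => by rw [← map_zsmul, smul_eq_mul, mul_one]
  have hτ : ∀ q, MonoidAlgebra.single q (1 : ℤ) • α 1 =
      τ q (MonoidAlgebra.single q (1 : ℤ) • α 1) := fun q => by
    conv_lhs => rw [← hu, hsmul, mul_one]
  have hsingle : ∀ (q : Q) (r : ℤ), MonoidAlgebra.single q r = r • MonoidAlgebra.single q (1 : ℤ) :=
    fun q r => by simp [MonoidAlgebra.smul_single]
  have hcoeff : ∀ (x : MonoidAlgebra ℤ Q) q,
      τ q (x • α 1) = x.coeff q • MonoidAlgebra.single q (1 : ℤ) • α 1 := by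
    intro x q
    induction x using MonoidAlgebra.induction_linear with
    | zero => simp
    | add x y hx hy => rw [add_smul, map_add, hx, hy, MonoidAlgebra.coeff_add, Finsupp.add_apply,
        add_smul]
    | single q' r =>
      rw [hsingle, smul_assoc, map_zsmul, hτ]
      by_cases h : q' = q
      · subst h
        rw [hself, ← hτ]
        simp
      · rw [hne _ _ h]
        simp [h]
  refine ⟨LinearEquiv.ofBijective (LinearMap.toSpanSingleton _ _ (α 1)) ⟨?_, ?_⟩⟩
  · rw [injective_iff_map_eq_zero]
    intro x hx
    ext q
    have h1 := hcoeff x q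
    rw [LinearMap.toSpanSingleton_apply] at hx
    rw [hx, map_zero] at h1
    have h2 := congrArg (MonoidAlgebra.single q⁻¹ (1 : ℤ) • ·) h1
    simp only [smul_zero] at h2
    rw [smul_comm, ← single_mul_smul, inv_mul_cancel, single_one_smul, ← hz] at h2
    exact hα (h2.symm.trans (map_zero α).symm)
  · rw [← LinearMap.range_eq_top, eq_top_iff]
    intro e _
    obtain ⟨s, hs⟩ := hsum e
    rw [← hs]
    refine Submodule.sum_mem _ fun q _ => ?_
    have h1 : τ q e =
        MonoidAlgebra.single q (1 : ℤ) • τ 1 (MonoidAlgebra.single q⁻¹ (1 : ℤ) • e) := by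
      rw [hsmul, mul_one, ← single_mul_smul, mul_inv_cancel, single_one_smul]
    obtain ⟨z, hz'⟩ := (hr _).1 (hself 1 (MonoidAlgebra.single q⁻¹ (1 : ℤ) • e))
    rw [h1, ← hz', hz z]
    refine Submodule.smul_mem _ _ (zsmul_mem ?_ z)
    exact ⟨1, by simp⟩

open TranslationCocycle Abelian

section Coinduced

variable {K G Q : Type} [Group K] [Group G] [Group Q] (ι : K →* G) (π : G →* Q)

theorem exists_iso_res_ring_translate :
    ∃ θ : (diag π).functor.obj (trivialGroupRingModule G) ≅
        (resFunctor π).obj (ModuleCat.of _ (MonoidAlgebra ℤ Q)),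
      ∀ q, translate π q (trivialGroupRingModule G) ≫ θ.hom =
        θ.hom ≫ (resFunctor π).map (ModuleCat.ofHom (LinearMap.toSpanSingleton _ _
          (MonoidAlgebra.single q (1 : ℤ)))) := by
  obtain ⟨ε⟩ := nonempty_trivialGroupRingModule_addEquiv G
  obtain ⟨θ, hθ⟩ := (diag π).exists_iso_res_ring (trivialGroupRingModule G) ε
    (fun g _ m => single_smul_trivialGroupRingModule g m)
  refine ⟨θ, fun q => ModuleCat.hom_ext ((diag π).linearMap_ext fun q' m => ?_)⟩
  refine (congrArg θ.hom (translate_single π q q' _ m)).trans ((hθ _ _).trans ?_)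
  refine Eq.trans ?_ (congrArg ((resFunctor π).map (ModuleCat.ofHom
    (LinearMap.toSpanSingleton _ _ (MonoidAlgebra.single q (1 : ℤ))))) (hθ q' m)).symm
  exact ((MonoidAlgebra.single_mul_single q' q (ε m) 1).trans (by rw [mul_one])).symm

/-- `Ext` of the group ring of the quotient is computed over the kernel, and right translations
permute the summands coming from the cosets. -/
theorem exists_addEquiv_ext_res (hπι : ∀ k, π (ι k) = 1) (hι : Function.Injective ι)
    (hπ : Function.Surjective π) (hexact : ι.range = π.ker) (n : ℕ) :
    ∃ Φ : extSelf (MonoidAlgebra.mapDomainRingHom ℤ π)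
        (ModuleCat.of _ (MonoidAlgebra ℤ G)) n ≃+
        Ext ((resFunctor ι).obj (trivialGroupRingModule G)) (resRing ι) n,
      ∀ q q' e e₁, Φ e₁ = extPost _ (fibreProj ι π hπι q') n (Φ e) →
        Φ (MonoidAlgebra.single q (1 : ℤ) • e₁) =
          extPost _ (fibreProj ι π hπι (q * q')) n (Φ (MonoidAlgebra.single q (1 : ℤ) • e)) := by
  obtain ⟨θ, hnat⟩ := exists_iso_res_ring_translate π
  obtain ⟨Ψ, hΨ⟩ : ∃ Ψ : Ext ((diag π).functor.obj (trivialGroupRingModule G))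
      (ModuleCat.of _ (MonoidAlgebra ℤ G)) n ≃+
      Ext ((resFunctor ι).obj (trivialGroupRingModule G)) (resRing ι) n,
      ∀ e, Ψ e = diagShapiro π hπι _ _ n e :=
    ⟨AddEquiv.ofBijective (diagShapiro π hπι (trivialGroupRingModule G)
      (ModuleCat.of _ (MonoidAlgebra ℤ G)) n) (diagShapiro_bijective π hπι hι hπ hexact _ _ n),
      AddEquiv.ofBijective_apply _ _⟩
  obtain ⟨Θ, hΘ⟩ : ∃ Θ : Ext ((resFunctor π).obj (ModuleCat.of _ (MonoidAlgebra ℤ Q)))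
      (ModuleCat.of _ (MonoidAlgebra ℤ G)) n ≃+
      Ext ((diag π).functor.obj (trivialGroupRingModule G)) (ModuleCat.of _ (MonoidAlgebra ℤ G)) n,
      ∀ e, Θ e = extPre θ.hom _ n e :=
    ⟨extCongr θ (Iso.refl _) n, extCongr_refl_apply θ⟩
  have key : ∀ (q : Q) e, Θ (extPre ((resFunctor π).map (ModuleCat.ofHom
      (LinearMap.toSpanSingleton _ _ (MonoidAlgebra.single q (1 : ℤ))))) _ n e) =
      extPre (translate π q _) _ n (Θ e) := by
    intro q e
    rw [hΘ, hΘ, ← extPre_comp, ← extPre_comp, hnat]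
  refine ⟨Θ.trans Ψ, fun q q' e e₁ h => ?_⟩
  have key' : ∀ e, (Θ.trans Ψ) (MonoidAlgebra.single q (1 : ℤ) • e) =
      diagShapiro π hπι _ _ n (extPre (translate π q _) _ n (Θ e)) := fun e =>
    (hΨ _).trans (congrArg (diagShapiro π hπι _ _ n) (key q e))
  rw [key', key']
  exact diagShapiro_translate π hπι hι hπ hexact q q' n _ (Θ e) (Θ e₁)
    ((hΨ _).symm.trans (h.trans (congrArg _ (hΨ _))))

theorem nonempty_extSelf_linearEquiv (hι : Function.Injective ι)
    (hπ : Function.Surjective π) (hexact : ι.range = π.ker) {n k : ℕ}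
    (hfr : HasFiniteResolution (MonoidAlgebra ℤ K) k (trivialGroupRingModule K))
    (hn : Nonempty (Ext (trivialGroupRingModule K) (ModuleCat.of _ (MonoidAlgebra ℤ K)) n ≃+ ℤ)) :
    Nonempty (MonoidAlgebra ℤ Q ≃ₗ[MonoidAlgebra ℤ Q]
      extSelf (MonoidAlgebra.mapDomainRingHom ℤ π) (ModuleCat.of _ (MonoidAlgebra ℤ G)) n) := by
  have hπι : ∀ k, π (ι k) = 1 := fun k => by
    rw [← MonoidHom.mem_ker, ← hexact]; exact ⟨k, rfl⟩
  obtain ⟨Φ, hΦ⟩ := exists_addEquiv_ext_res ι π hπι hι hπ hexact n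
  obtain ⟨η⟩ := nonempty_res_trivial_iso ι
  obtain ⟨β⟩ := hn
  obtain ⟨p, i, hpi, hip⟩ := exists_fibreProj_factorization ι hπι hι hπ hexact 1
  have hfr' : HasFiniteResolution (MonoidAlgebra ℤ K) k
      ((resFunctor ι).obj (trivialGroupRingModule G)) := hfr.congr η.symm.toLinearEquiv
  let γ := ((extCongr η (Iso.refl (ModuleCat.of _ (MonoidAlgebra ℤ K))) n).symm.trans β).symm
  have hpp : ∀ x, extPost ((resFunctor ι).obj (trivialGroupRingModule G)) p n
      (extPost _ i n x) = x := fun x => by rw [← extPost_comp, hip, extPost_id]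
  let τ : Q → extSelf (MonoidAlgebra.mapDomainRingHom ℤ π)
      (ModuleCat.of _ (MonoidAlgebra ℤ G)) n →+ extSelf (MonoidAlgebra.mapDomainRingHom ℤ π)
      (ModuleCat.of _ (MonoidAlgebra ℤ G)) n := fun q =>
    Φ.symm.toAddMonoidHom.comp ((extPost _ (fibreProj ι π hπι q) n).comp Φ.toAddMonoidHom)
  have hτ : ∀ q e, Φ (τ q e) = extPost _ (fibreProj ι π hπι q) n (Φ e) := fun q e =>
    Φ.apply_symm_apply _
  refine nonempty_linearEquiv_of_decomposition τ (fun q e => Φ.injective ?_)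
    (fun q q' h e => Φ.injective ?_) (fun e => ?_) (fun q q' e => Φ.injective ?_)
    (Φ.symm.toAddMonoidHom.comp ((extPost _ i n).comp γ.toAddMonoidHom)) ?_ (fun e => ?_)
  · rw [hτ, hτ, ← extPost_comp, fibreProj_comp_self]
  · rw [hτ, hτ, ← extPost_comp, fibreProj_comp_of_ne ι π hπι h, extPost_zero, map_zero]
  · obtain ⟨s, hs⟩ := extPost_sum_eq_self (fibreProj ι π hπι)
      (fibreProj_sum_eq_self ι π hπι) hfr' (Φ e)
    refine ⟨s, Φ.injective ?_⟩
    rw [map_sum]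
    exact (Finset.sum_congr rfl fun q _ => hτ q e).trans (hs s subset_rfl)
  · rw [hτ]
    exact hΦ q q' e (τ q' e) (hτ q' e)
  · exact Φ.symm.injective.comp ((Function.LeftInverse.injective hpp).comp γ.injective)
  · constructor
    · intro he
      refine ⟨γ.symm (extPost _ p n (Φ e)), Φ.injective ?_⟩
      refine (Φ.apply_symm_apply _).trans ?_
      refine (congrArg (extPost _ i n) (γ.apply_symm_apply _)).trans ?_
      rw [← extPost_comp, hpi, ← hτ, he]
    · rintro ⟨z, rfl⟩
      refine Φ.injective ((hτ _ _).trans ?_)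
      have h1 : Φ ((Φ.symm.toAddMonoidHom.comp ((extPost _ i n).comp γ.toAddMonoidHom)) z) =
        extPost _ i n (γ z) := Φ.apply_symm_apply _
      rw [h1, ← hpi, extPost_comp, hpp]

theorem subsingleton_ext_res_ring (hι : Function.Injective ι)
    (hπ : Function.Surjective π) (hexact : ι.range = π.ker) {n k : ℕ}
    (hfr : HasFiniteResolution (MonoidAlgebra ℤ K) k (trivialGroupRingModule K))
    (hn : Subsingleton (Ext (trivialGroupRingModule K) (ModuleCat.of _ (MonoidAlgebra ℤ K)) n)) :
    Subsingleton (Ext ((resFunctor π).obj (ModuleCat.of _ (MonoidAlgebra ℤ Q)))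
      (ModuleCat.of _ (MonoidAlgebra ℤ G)) n) := by
  have hπι : ∀ k, π (ι k) = 1 := fun k => by
    rw [← MonoidHom.mem_ker, ← hexact]; exact ⟨k, rfl⟩
  obtain ⟨Φ, -⟩ := exists_addEquiv_ext_res ι π hπι hι hπ hexact n
  obtain ⟨η⟩ := nonempty_res_trivial_iso ι
  have hfr' : HasFiniteResolution (MonoidAlgebra ℤ K) k
      ((resFunctor ι).obj (trivialGroupRingModule G)) := hfr.congr η.symm.toLinearEquiv
  have hs : Subsingleton (Ext ((resFunctor ι).obj (trivialGroupRingModule G))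
      (ModuleCat.of _ (MonoidAlgebra ℤ K)) n) :=
    (extCongr η (Iso.refl (ModuleCat.of _ (MonoidAlgebra ℤ K))) n).symm.injective.subsingleton
  suffices h : ∀ x : Ext ((resFunctor ι).obj (trivialGroupRingModule G)) (resRing ι) n, x = 0 from
    ⟨fun a b => Φ.injective ((h _).trans (h _).symm)⟩
  intro x
  obtain ⟨s, hs⟩ := extPost_sum_eq_self (fibreProj ι π hπι)
      (fibreProj_sum_eq_self ι π hπι) hfr' x
  rw [← hs s subset_rfl]
  refine Finset.sum_eq_zero fun q _ => ?_
  obtain ⟨p, i, hpi, -⟩ := exists_fibreProj_factorization ι hπι hι hπ hexact q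
  rw [← hpi, extPost_comp, Subsingleton.elim (extPost _ p n x) 0, map_zero]

end Coinduced

namespace HasFiniteResolution

theorem of_retract {R : Type} [Ring R] {n : ℕ} {M N : Type} [AddCommGroup M] [Module R M]
    [AddCommGroup N] [Module R N] (i : M →ₗ[R] N) (p : N →ₗ[R] M) (hip : ∀ x, p (i x) = x)
    (h : HasFiniteResolution R n N) : HasFiniteResolution R n M := by
  let f : N →ₗ[R] M × LinearMap.ker p := p.prod
    ((LinearMap.id - i ∘ₗ p).codRestrict _ fun x => by simp [hip])
  let g : M × LinearMap.ker p →ₗ[R] N := i.coprod (LinearMap.ker p).subtype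
  refine (congr (LinearEquiv.ofLinearMap f g ?_ ?_) h).fst
  · refine LinearMap.ext fun x => Prod.ext ?_ (Subtype.ext ?_)
    · have := x.2.2
      rw [LinearMap.mem_ker] at this
      simp [f, g, hip, this]
    · have := x.2.2
      rw [LinearMap.mem_ker] at this
      simp [f, g, hip, this]
  · refine LinearMap.ext fun x => ?_
    simp [f, g]

theorem fin_pi {R : Type} [Ring R] {n : ℕ} {M : Type} [AddCommGroup M] [Module R M]
    (h : HasFiniteResolution R n M) (k : ℕ) : HasFiniteResolution R n (Fin k → M) := by
  induction k with
  | zero =>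
    have : HasFiniteResolution R 0 (Fin 0 → M) := ⟨inferInstance, inferInstance⟩
    exact this.mono (Nat.zero_le n)
  | succ k ih =>
    refine congr (Fin.consLinearEquiv R fun _ => M) ?_
    exact extension (LinearMap.inl R M (Fin k → M)) (LinearMap.snd R M (Fin k → M))
      LinearMap.inl_injective Prod.snd_surjective (Function.Exact.inl_snd) h ih

/-- If the restriction of scalars of the ring `S` has a finite resolution, then so does the
restriction of scalars of any `S`-module with a finite resolution. -/
theorem restrictScalars {R S : Type} [Ring R] [Ring S] (φ : R →+* S) {n : ℕ}
    (h : HasFiniteResolution R n ((ModuleCat.restrictScalars φ).obj (ModuleCat.of S S)))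
    {k : ℕ} : ∀ {M : ModuleCat.{0} S} (_ : HasFiniteResolution S k M),
    HasFiniteResolution R (n + k) ((ModuleCat.restrictScalars φ).obj M) := by
  have h0 : ∀ {P : ModuleCat.{0} S} (_ : Module.Finite S P) (_ : Module.Projective S P),
      HasFiniteResolution R n ((ModuleCat.restrictScalars φ).obj P) := by
    intro P hf hp
    obtain ⟨k, p, hp⟩ := Module.Finite.exists_fin' S P
    obtain ⟨s, hs⟩ := Module.projective_lifting_property p LinearMap.id hp
    let e : (Fin k → (ModuleCat.restrictScalars φ).obj (ModuleCat.of S S)) ≃ₗ[R]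
        (ModuleCat.restrictScalars φ).obj (ModuleCat.of S (Fin k → S)) :=
      { AddEquiv.refl (Fin k → S) with map_smul' := fun _ _ => rfl }
    exact of_retract ((ModuleCat.restrictScalars φ).map (ModuleCat.ofHom s)).hom
      ((ModuleCat.restrictScalars φ).map (ModuleCat.ofHom p)).hom
      (fun x => LinearMap.congr_fun hs x) (congr e (h.fin_pi k))
  induction k with
  | zero => exact fun hM => h0 hM.1 hM.2
  | succ k ih =>
    intro M hM
    obtain ⟨A, P, i, p, w, hS, hA, hf, hP⟩ := hM.exists_shortExact
    have hS' := shortExact_map_restrictScalars φ hS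
    exact quotient _ _ hS'.moduleCat_injective_f hS'.moduleCat_surjective_g
      ((ShortComplex.ShortExact.moduleCat_exact_iff_function_exact _).1 hS'.exact) (ih hA)
      ((h0 hf ((IsProjective.iff_projective _).2 hP)).mono (Nat.le_add_right n k))

end HasFiniteResolution

namespace TranslationCocycle

variable {K G Q : Type} [Group K] [Group G] [Group Q] {ι : K →* G} {π : G →* Q}

variable (c : TranslationCocycle π (MonoidAlgebra ℤ K))

theorem finite_carrier (hπι : ∀ k, π (ι k) = 1)
    (hc : ∀ k, c.toFun (ι k) 1 = MonoidAlgebra.single k 1) (hπ : Function.Surjective π) (M : Type)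
    [AddCommGroup M] [Module (MonoidAlgebra ℤ K) M] [hM : Module.Finite (MonoidAlgebra ℤ K) M] :
    Module.Finite (MonoidAlgebra ℤ G) (c.Carrier M) := by
  classical
  obtain ⟨S, hS⟩ := hM.fg_top
  let N := Submodule.span (MonoidAlgebra ℤ G)
    ((S.image (c.single 1) : Finset (c.Carrier M)) : Set (c.Carrier M))
  have h1 : ∀ m : M, c.single 1 m ∈ N := by
    intro m
    have hm : m ∈ Submodule.span (MonoidAlgebra ℤ K) (S : Set M) := hS ▸ Submodule.mem_top
    induction hm using Submodule.span_induction with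
    | mem x hx => exact Submodule.subset_span (Finset.mem_coe.2 (Finset.mem_image_of_mem _ hx))
    | zero => rw [map_zero]; exact N.zero_mem
    | add x y _ _ hx hy => rw [map_add]; exact N.add_mem hx hy
    | smul a x _ hx =>
      induction a using MonoidAlgebra.induction_linear with
      | zero => rw [zero_smul, map_zero]; exact N.zero_mem
      | add a b ha hb => rw [add_smul, map_add]; exact N.add_mem ha hb
      | single k r =>
        have : MonoidAlgebra.single k r = r • MonoidAlgebra.single k (1 : ℤ) := by
          simp [MonoidAlgebra.smul_single]
        rw [this, smul_assoc, map_zsmul]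
        refine zsmul_mem ?_ r
        have h2 := c.single_smul_single (ι k) 1 x
        rw [hπι, one_mul, hc] at h2
        rw [← h2]
        exact N.smul_mem _ hx
  refine ⟨⟨S.image (c.single 1), eq_top_iff.2 fun x _ => ?_⟩⟩
  have h2 : ∀ q m, c.single q m ∈ N := by
    intro q m
    obtain ⟨g, rfl⟩ := hπ q
    rw [single_eq_smul_single_one]
    exact N.smul_mem _ (h1 _)
  have h3 := c.hom_congr N.mkQ.toAddMonoidHom 0
    (fun q m => (Submodule.Quotient.mk_eq_zero N).2 (h2 q m)) x
  exact (Submodule.Quotient.mk_eq_zero N).1 h3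

theorem hasFiniteResolution_functor_obj (hπι : ∀ k, π (ι k) = 1)
    (hc : ∀ k, c.toFun (ι k) 1 = MonoidAlgebra.single k 1) (hπ : Function.Surjective π)
    (hexact : ι.range = π.ker) {n : ℕ} : ∀ {M : ModuleCat.{0} (MonoidAlgebra ℤ K)}
    (_ : HasFiniteResolution (MonoidAlgebra ℤ K) n M),
    HasFiniteResolution (MonoidAlgebra ℤ G) n (c.functor.obj M) := by
  have h0 : ∀ {P : ModuleCat.{0} (MonoidAlgebra ℤ K)} (_ : Module.Finite (MonoidAlgebra ℤ K) P)
      (_ : Projective P), HasFiniteResolution (MonoidAlgebra ℤ G) 0 (c.functor.obj P) := by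
    intro P hf hP
    have hP' : Projective ((ModuleCat.restrictScalars (RingHom.id (MonoidAlgebra ℤ K))).obj P) :=
      Projective.of_iso ((ModuleCat.restrictScalarsId _).app P).symm hP
    exact ⟨c.finite_carrier hπι hc hπ P, (IsProjective.iff_projective _).2
      (c.projective_functor_obj (RingHom.id _) P hP' hπι hc hπ hexact)⟩
  induction n with
  | zero => exact fun hM => h0 hM.1 ((IsProjective.iff_projective _).1 hM.2)
  | succ n ih =>
    intro M hM
    obtain ⟨A, P, i, p, w, hS, hA, hf, hP⟩ := hM.exists_shortExact
    have hS' := c.shortExact_map hS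
    exact HasFiniteResolution.quotient _ _ hS'.moduleCat_injective_f hS'.moduleCat_surjective_g
      ((ShortComplex.ShortExact.moduleCat_exact_iff_function_exact _).1 hS'.exact) (ih hA)
      ((h0 hf hP).mono (Nat.zero_le n))

/-- The cocycle for which induction is the induction of modules from the kernel. -/
theorem exists_induction_cocycle (hι : Function.Injective ι) (hπ : Function.Surjective π)
    (hexact : ι.range = π.ker) : ∃ c : TranslationCocycle π (MonoidAlgebra ℤ K),
      (∀ g q, ∃ k, c.toFun g q = MonoidAlgebra.single k 1) ∧
      ∀ k, c.toFun (ι k) 1 = MonoidAlgebra.single k 1 := by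
  have hπι : ∀ k, π (ι k) = 1 := fun k => by
    rw [← MonoidHom.mem_ker, ← hexact]; exact ⟨k, rfl⟩
  obtain ⟨s, hs, hs1⟩ := exists_normalized_section π hπ
  have h : ∀ g q, ∃ k, ι k = (s (π g * q))⁻¹ * g * s q := fun g q => by
    have : (s (π g * q))⁻¹ * g * s q ∈ ι.range := by
      rw [hexact, MonoidHom.mem_ker]
      simp [hs, mul_assoc]
    exact this
  choose κ hκ using h
  have h1 : ∀ q, κ 1 q = 1 := fun q => hι (by simp [hκ])
  have h2 : ∀ g h q, κ (g * h) q = κ g (π h * q) * κ h q := fun g h q => hι (by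
    simp [hκ, mul_assoc])
  have h3 : ∀ k, κ (ι k) 1 = k := fun k => hι (by simp [hκ, hπι, hs1])
  exact ⟨⟨fun g q => MonoidAlgebra.single (κ g q) 1, fun q => by rw [h1]; rfl, fun g h q => by
    rw [h2, MonoidAlgebra.single_mul_single, one_mul]⟩, fun g q => ⟨_, rfl⟩, fun k => by
    simp only [h3]⟩

end TranslationCocycle

open TranslationCocycle in
theorem hasFiniteResolution_trivial_of_extension {K G Q : Type} [Group K] [Group G] [Group Q]
    {ι : K →* G} {π : G →* Q} (hι : Function.Injective ι) (hπ : Function.Surjective π)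
    (hexact : ι.range = π.ker) {m n : ℕ}
    (hK : HasFiniteResolution (MonoidAlgebra ℤ K) m (trivialGroupRingModule K))
    (hQ : HasFiniteResolution (MonoidAlgebra ℤ Q) n (trivialGroupRingModule Q)) :
    HasFiniteResolution (MonoidAlgebra ℤ G) (m + n) (trivialGroupRingModule G) := by
  have hπι : ∀ k, π (ι k) = 1 := fun k => by
    rw [← MonoidHom.mem_ker, ← hexact]; exact ⟨k, rfl⟩
  obtain ⟨c, hc1, hc2⟩ := exists_induction_cocycle hι hπ hexact
  obtain ⟨ε⟩ := nonempty_trivialGroupRingModule_addEquiv K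
  obtain ⟨θ, -⟩ := c.exists_iso_res_ring (trivialGroupRingModule K) ε fun g q z => by
    obtain ⟨k, hk⟩ := hc1 g q
    rw [hk, single_smul_trivialGroupRingModule]
  obtain ⟨η⟩ := nonempty_res_trivial_iso π
  have h1 := (c.hasFiniteResolution_functor_obj hπι hc2 hπ hexact hK).congr θ.toLinearEquiv
  exact (HasFiniteResolution.restrictScalars _ h1 hQ).congr η.toLinearEquiv

section Dimension

open Abelian

theorem nonempty_groupCohomology_leftRegular_addEquiv (G : Type) [Group G] (n : ℕ) :
    Nonempty (groupCohomology (Rep.leftRegular ℤ G) n ≃+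
      Ext (trivialGroupRingModule G) (ModuleCat.of _ (MonoidAlgebra ℤ G)) n) := by
  obtain ⟨e⟩ := nonempty_groupCohomology_addEquiv_ext (Rep.leftRegular ℤ G) n
  obtain ⟨θ⟩ := nonempty_iso_leftRegular G
  exact ⟨e.trans (extCongr (Iso.refl _) θ n)⟩

theorem cohDim_eq_of_subsingleton {G : Type} [Group G] (hG : IsFP G) {n : ℕ}
    (h : ∀ i ≠ n, Subsingleton (groupCohomology (Rep.leftRegular ℤ G) i))
    (hn : Nonempty (groupCohomology (Rep.leftRegular ℤ G) n ≃+ ℤ)) : cohDim G = n := by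
  obtain ⟨k, hk⟩ := (isFP_iff_hasFiniteResolution G).1 hG
  refine le_antisymm (sSup_le ?_) (le_sSup ⟨n, ⟨Rep.leftRegular ℤ G, ?_⟩, rfl⟩)
  · rintro _ ⟨i, ⟨M, hM⟩, rfl⟩
    by_contra! hi
    obtain ⟨e⟩ := nonempty_groupCohomology_addEquiv_ext M i
    have hi' : n < i := by exact_mod_cast hi
    have := subsingleton_ext_of_subsingleton_ext_self hk (n := n) (fun j hj => by
      have := h j hj.ne'
      obtain ⟨e'⟩ := nonempty_groupCohomology_leftRegular_addEquiv G j
      exact e'.symm.injective.subsingleton)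
      (Rep.equivalenceModuleMonoidAlgebra.functor.obj M) i hi'
    exact not_subsingleton _ e.injective.subsingleton
  · obtain ⟨e⟩ := hn
    exact e.symm.injective.nontrivial

end Dimension

/-- Let `K` and `Q` be Poincaré duality groups and let `1 → K → G → Q → 1` be a short
exact sequence.  Then `G` is a Poincaré duality group and `cd(G) = cd(K) + cd(Q)`. -/
theorem poincare_duality_extension
    {K G Q : Type} [Group K] [Group G] [Group Q]
    (ι : K →* G) (π : G →* Q) (hι : Function.Injective ι)
    (hπ : Function.Surjective π) (hexact : ι.range = π.ker)
    (hK : IsPoincareDualityGroup K) (hQ : IsPoincareDualityGroup Q) :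
    IsPoincareDualityGroup G ∧ cohDim G = cohDim K + cohDim Q := by
  obtain ⟨hK1, m, hK2, ⟨eK⟩⟩ := hK
  obtain ⟨hQ1, n, hQ2, ⟨eQ⟩⟩ := hQ
  obtain ⟨a, ha⟩ := (isFP_iff_hasFiniteResolution K).1 hK1
  obtain ⟨b, hb⟩ := (isFP_iff_hasFiniteResolution Q).1 hQ1
  have hG1 : IsFP G := (isFP_iff_hasFiniteResolution G).2
    ⟨_, hasFiniteResolution_trivial_of_extension hι hπ hexact ha hb⟩
  have hX : ∀ i ≠ m, Subsingleton (Abelian.Ext ((resFunctor π).obj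
      (ModuleCat.of _ (MonoidAlgebra ℤ Q))) (ModuleCat.of _ (MonoidAlgebra ℤ G)) i) := by
    intro i hi
    have := hK2 i hi
    obtain ⟨e⟩ := nonempty_groupCohomology_leftRegular_addEquiv K i
    exact subsingleton_ext_res_ring ι π hι hπ hexact ha e.symm.injective.subsingleton
  obtain ⟨T⟩ := nonempty_extSelf_linearEquiv ι π hι hπ hexact (n := m) ha (by
    obtain ⟨e⟩ := nonempty_groupCohomology_leftRegular_addEquiv K m
    exact ⟨e.symm.trans eK⟩)
  obtain ⟨η⟩ := nonempty_res_trivial_iso π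
  have hshift : ∀ j, Nonempty (groupCohomology (Rep.leftRegular ℤ G) (m + j) ≃+
      groupCohomology (Rep.leftRegular ℤ Q) j) := by
    intro j
    obtain ⟨e₁⟩ := nonempty_groupCohomology_leftRegular_addEquiv G (m + j)
    obtain ⟨e₂⟩ := nonempty_ext_addEquiv_ext_extSelf (MonoidAlgebra.mapDomainRingHom ℤ π)
      (ModuleCat.of _ (MonoidAlgebra ℤ G)) m hX hb j
    obtain ⟨e₃⟩ := nonempty_groupCohomology_leftRegular_addEquiv Q j
    exact ⟨((e₁.trans (extCongr η (Iso.refl _) (m + j))).trans e₂).trans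
      ((extCongr (Iso.refl _) T.symm.toModuleIso j).trans e₃.symm)⟩
  have hG2 : ∀ i ≠ m + n, Subsingleton (groupCohomology (Rep.leftRegular ℤ G) i) := by
    intro i hi
    rcases lt_or_ge i m with him | him
    · obtain ⟨e₁⟩ := nonempty_groupCohomology_leftRegular_addEquiv G i
      have := subsingleton_ext_of_lt (MonoidAlgebra.mapDomainRingHom ℤ π)
        (ModuleCat.of _ (MonoidAlgebra ℤ G)) m hX hb i him
      exact (e₁.trans (extCongr η (Iso.refl _) i)).injective.subsingleton
    · obtain ⟨j, rfl⟩ := Nat.exists_eq_add_of_le him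
      obtain ⟨e⟩ := hshift j
      have := hQ2 j (by omega)
      exact e.injective.subsingleton
  have hG3 : Nonempty (groupCohomology (Rep.leftRegular ℤ G) (m + n) ≃+ ℤ) := by
    obtain ⟨e⟩ := hshift n
    exact ⟨e.trans eQ⟩
  refine ⟨⟨hG1, m + n, hG2, hG3⟩, ?_⟩
  rw [cohDim_eq_of_subsingleton hG1 hG2 hG3, cohDim_eq_of_subsingleton hK1 hK2 ⟨eK⟩,
    cohDim_eq_of_subsingleton hQ1 hQ2 ⟨eQ⟩, Nat.cast_add]
end
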